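/- Let B be a measurable collision kernel with 0 ≤ B ≤ ‖B‖_∞ < ∞, μ > 0, and let (f^μ_j)_{j≥1} be nonnegative symmetric probability densities solving the grand-canonical BBGKY hierarchy, f(t) a probability-density solution of the homogeneous Boltzmann equation, and E_j(t) the correlation errors. Assume that for some C₀ ≥ 1 one has ‖E_j(0)‖_{L¹} ≤ (j²/μ)^{j/2} C₀^j for all j ≥ 1. Then there exist t₀ > 0 sufficiently small and A > 0 (both explicitly computable, depending only on ‖B‖_∞ and C₀) such that for all 0 ≤ t ≤ t₀ and all j ≥ 1, ‖E_j(t)‖_{L¹} ≤ (j²/μ)^{j/2} (A C₀)^j. -/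

import Mathlib

open MeasureTheory Finset Real
open scoped BigOperators

noncomputable section

/-- The one-particle velocity space `ℝ³`. -/
abbrev V3 : Type := EuclideanSpace ℝ (Fin 3)

/-- Configurations of `n` velocities. -/
abbrev Conf (n : ℕ) : Type := Fin n → V3

/-- The surface measure on the unit sphere `S² ⊂ ℝ³` (total mass `4π`). -/
def sphMeasure : Measure (Metric.sphere (0 : V3) 1) := (volume : Measure V3).toSphere

/-- Post-collisional velocities `(v', w')` with scattering vector `ω`. -/
def collide (ω v w : V3) : V3 × V3 :=
  (v - (inner ℝ ω (v - w) : ℝ) • ω, w + (inner ℝ ω (v - w) : ℝ) • ω)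

/-- The configuration after a collision of particles `i` and `s`. -/
def collideConf {n : ℕ} (ω : V3) (i s : Fin n) (V : Conf n) : Conf n :=
  Function.update (Function.update V i (collide ω (V i) (V s)).1) s (collide ω (V i) (V s)).2

/-- The Kac collision operator `T_{i,s}`. -/
def KacT {n : ℕ} (Bk : V3 → V3 → ℝ) (i s : Fin n) (W : Conf n → ℝ) : Conf n → ℝ :=
  fun V => ∫ ω : Metric.sphere (0 : V3) 1,
    Bk ω (V i - V s) * (W (collideConf ω i s V) - W V) ∂sphMeasure

/-- The full Kac generator `T_n = Σ_{i<s} T_{i,s}`. -/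
def KacTn {n : ℕ} (Bk : V3 → V3 → ℝ) (W : Conf n → ℝ) : Conf n → ℝ :=
  fun V => ∑ i : Fin n, ∑ s : Fin n, if i < s then KacT Bk i s W V else 0

/-- The hierarchy collision operator `C_{i,j+1}`. -/
def Chier {j : ℕ} (Bk : V3 → V3 → ℝ) (i : Fin j) (g : Conf (j + 1) → ℝ) : Conf j → ℝ :=
  fun V => ∫ u : V3, ∫ ω : Metric.sphere (0 : V3) 1,
    Bk ω (V i - u) *
      (g (Function.update (Function.update (Fin.snoc V u) i.castSucc (collide ω (V i) u).1)
            (Fin.last j) (collide ω (V i) u).2)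
        - g (Fin.snoc V u)) ∂sphMeasure

/-- `C_{j+1} = Σ_{i=1}^j C_{i,j+1}`. -/
def ChierFull {j : ℕ} (Bk : V3 → V3 → ℝ) (g : Conf (j + 1) → ℝ) : Conf j → ℝ :=
  fun V => ∑ i : Fin j, Chier Bk i g V

/-- The homogeneous Boltzmann collision operator `Q(f,f)`. -/
def Qcol (Bk : V3 → V3 → ℝ) (f : V3 → ℝ) : V3 → ℝ :=
  fun v => ∫ w : V3, ∫ ω : Metric.sphere (0 : V3) 1,
    Bk ω (v - w) * (f (collide ω v w).1 * f (collide ω v w).2 - f v * f w) ∂sphMeasure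

/-- Tensor product `f^{⊗n}`. -/
def tens (f : V3 → ℝ) (n : ℕ) : Conf n → ℝ := fun V => ∏ i : Fin n, f (V i)

/-- Symmetry of a function of `n` velocities. -/
def IsSymm' {n : ℕ} (W : Conf n → ℝ) : Prop :=
  ∀ σ : Equiv.Perm (Fin n), ∀ V : Conf n, W (V ∘ σ) = W V

/-- `L¹` norm on `Conf n` (with respect to Lebesgue measure). -/
def L1n {n : ℕ} (g : Conf n → ℝ) : ℝ := ∫ V : Conf n, |g V|

/-- A bounded measurable collision kernel: `0 ≤ B ≤ Bsup`. -/
def IsKernel (Bk : V3 → V3 → ℝ) (Bsup : ℝ) : Prop :=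
  Measurable (Function.uncurry Bk) ∧ (∀ ω Vv : V3, 0 ≤ Bk ω Vv ∧ Bk ω Vv ≤ Bsup)

/-- `f : ℝ → V3 → ℝ` is a probability-density solution of the homogeneous
Boltzmann equation `∂_t f = Q(f,f)` (the derivative taken pointwise in `v`). -/
def SolvesBoltzmann (Bk : V3 → V3 → ℝ) (f : ℝ → V3 → ℝ) : Prop :=
  (∀ t : ℝ, 0 ≤ t → (∀ v, 0 ≤ f t v) ∧ Integrable (f t) ∧ ∫ v : V3, f t v = 1) ∧
  (∀ t : ℝ, 0 ≤ t → ∀ v : V3, HasDerivAt (fun τ => f τ v) (Qcol Bk (f t) v) t)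

/-- The correlation error `E_j = Σ_{K ⊆ J} (−1)^{|K|} f^μ_{J∖K} f^{⊗K}`. -/
def corrErr (fmu : ∀ k : ℕ, Conf k → ℝ) (f : V3 → ℝ) (j : ℕ) : Conf j → ℝ :=
  fun V => ∑ K : Finset (Fin j),
    (-1 : ℝ) ^ K.card * fmu Kᶜ.card (fun a => (V ((Kᶜ.orderIsoOfFin rfl a : Fin j)))) *
      ∏ i ∈ K, f (V i)

/-- Evaluation of a symmetric family at the variables with indices in `A`. -/
def evalAt {n : ℕ} (Efam : ∀ k : ℕ, Conf k → ℝ) (A : Finset (Fin n)) : Conf n → ℝ :=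
  fun V => Efam A.card (fun a => V ((A.orderIsoOfFin rfl a : Fin n)))



lemma collideConf_apply_l {n : ℕ} (ω : V3) {i s : Fin n} (h : i ≠ s) (V : Conf n) :
    collideConf ω i s V i = V i - (inner ℝ ω (V i - V s) : ℝ) • ω := by
  simp [collideConf, collide, Function.update_of_ne h]

lemma collideConf_apply_r {n : ℕ} (ω : V3) {i s : Fin n} (V : Conf n) :
    collideConf ω i s V s = V s + (inner ℝ ω (V i - V s) : ℝ) • ω := by
  simp [collideConf, collide]

lemma collideConf_apply_o {n : ℕ} (ω : V3) {i s k : Fin n} (h : k ≠ i) (h' : k ≠ s) (V : Conf n) :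
    collideConf ω i s V k = V k := by
  simp [collideConf, Function.update_of_ne h, Function.update_of_ne h']

/-- The collision map as a linear map. -/
def collideLin {n : ℕ} (ω : V3) {i s : Fin n} (h : i ≠ s) : Conf n →ₗ[ℝ] Conf n where
  toFun := collideConf ω i s
  map_add' V W := by
    funext k
    by_cases hi : k = i
    · subst hi
      simp only [collideConf_apply_l ω h, Pi.add_apply, add_sub_add_comm, inner_add_right, add_smul]
    · by_cases hs : k = s
      · subst hs
        simp only [collideConf_apply_r ω, Pi.add_apply, add_sub_add_comm, inner_add_right, add_smul]
        abel
      · simp [collideConf_apply_o ω hi hs]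
  map_smul' c V := by
    funext k
    by_cases hi : k = i
    · subst hi
      simp only [collideConf_apply_l ω h, Pi.smul_apply, ← smul_sub, inner_smul_right, RingHom.id_apply,
        mul_smul]
    · by_cases hs : k = s
      · subst hs
        simp only [collideConf_apply_r ω, Pi.smul_apply, ← smul_sub, ← smul_add, inner_smul_right,
          RingHom.id_apply, mul_smul]
      · simp [collideConf_apply_o ω hi hs]

lemma collideConf_invol {n : ℕ} (ω : V3) (hω : ‖ω‖ = 1) {i s : Fin n} (h : i ≠ s) (V : Conf n) :
    collideConf ω i s (collideConf ω i s V) = V := by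
  have hin : (inner ℝ ω ω : ℝ) = 1 := by simp [hω]
  have key : (inner ℝ ω (collideConf ω i s V i - collideConf ω i s V s) : ℝ)
      = - inner ℝ ω (V i - V s) := by
    rw [collideConf_apply_l ω h, collideConf_apply_r ω]
    simp only [inner_sub_right, inner_add_right, inner_smul_right, hin]
    ring
  funext k
  by_cases hi : k = i
  · subst hi
    rw [collideConf_apply_l ω h, key, collideConf_apply_l ω h]
    simp
  · by_cases hs : k = s
    · subst hs
      rw [collideConf_apply_r ω, key, collideConf_apply_r ω]
      simp
    · rw [collideConf_apply_o ω hi hs, collideConf_apply_o ω hi hs]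

lemma collideConf_map {n : ℕ} (ω : V3) (hω : ‖ω‖ = 1) {i s : Fin n} (h : i ≠ s) :
    Measure.map (collideConf ω i s) (volume : Measure (Conf n)) = volume := by
  have hcomp : (collideLin ω h) ∘ₗ (collideLin ω h) = LinearMap.id := by
    ext1 k
    ext1 V
    exact collideConf_invol ω hω h _
  have hdet : LinearMap.det (collideLin ω h) * LinearMap.det (collideLin ω h) = 1 := by
    rw [← LinearMap.det_comp, hcomp, LinearMap.det_id]
  have hne : LinearMap.det (collideLin ω h) ≠ 0 := by
    intro h0
    rw [h0] at hdet
    simp at hdet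
  have := Measure.map_linearMap_addHaar_eq_smul_addHaar (volume : Measure (Conf n)) hne
  have habs : |(LinearMap.det (collideLin ω h))⁻¹| = 1 := by
    rw [abs_inv]
    have : |LinearMap.det (collideLin ω h)| * |LinearMap.det (collideLin ω h)| = 1 := by
      rw [← abs_mul, hdet, abs_one]
    have h2 : |LinearMap.det (collideLin ω h)| = 1 := by
      nlinarith [abs_nonneg (LinearMap.det (collideLin ω h))]
    rw [h2, inv_one]
  rw [habs, ENNReal.ofReal_one, one_smul] at this
  exact this

instance : IsFiniteMeasure sphMeasure := by
  unfold sphMeasure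
  infer_instance

lemma collide_measurable {n : ℕ} (i s : Fin n) :
    Measurable (fun p : (Metric.sphere (0 : V3) 1) × Conf n => collideConf (p.1 : V3) i s p.2) := by
  rw [measurable_pi_iff]
  intro k
  by_cases hs : k = s
  · subst hs
    simp only [collideConf_apply_r]
    fun_prop
  · by_cases hi : k = i
    · subst hi
      simp only [collideConf_apply_l _ hs]
      fun_prop
    · simp only [collideConf_apply_o _ hi hs]
      fun_prop

lemma collide_skew {n : ℕ} {i s : Fin n} (h : i ≠ s) :
    MeasurePreserving (fun p : (Metric.sphere (0 : V3) 1) × Conf n =>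
        (p.1, collideConf (p.1 : V3) i s p.2))
      (sphMeasure.prod volume) (sphMeasure.prod volume) := by
  refine (MeasurePreserving.id sphMeasure).skew_product
    (g := fun (ω : Metric.sphere (0 : V3) 1) V => collideConf (ω : V3) i s V)
    (collide_measurable i s) ?_
  refine Filter.Eventually.of_forall fun ω => collideConf_map _ ?_ h
  simp

/-- Integrand of the Kac operator. -/
def KacI {n : ℕ} (Bk : V3 → V3 → ℝ) (i s : Fin n) (W : Conf n → ℝ) :
    (Metric.sphere (0 : V3) 1) × Conf n → ℝ := fun p =>
  Bk p.1 (p.2 i - p.2 s) * (W (collideConf p.1 i s p.2) - W p.2)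

/-- The constant `2 |B| |S²|`. -/
def betaE (Bsup : ℝ) : ℝ := 2 * |Bsup| * sphMeasure.real Set.univ

lemma betaE_nonneg (Bsup : ℝ) : 0 ≤ betaE Bsup := by unfold betaE; positivity

section Kac
variable {n : ℕ} {Bk : V3 → V3 → ℝ} {Bsup : ℝ} {i s : Fin n} {W : Conf n → ℝ}

lemma KacI_parts (h : i ≠ s) (hW : Integrable W) :
    Integrable (fun p : (Metric.sphere (0 : V3) 1) × Conf n => W p.2) (sphMeasure.prod volume) ∧
    Integrable (fun p : (Metric.sphere (0 : V3) 1) × Conf n => W (collideConf p.1 i s p.2))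
      (sphMeasure.prod volume) := by
  have h1 : Integrable (fun p : (Metric.sphere (0 : V3) 1) × Conf n => W p.2)
      (sphMeasure.prod volume) := hW.comp_snd _
  refine ⟨h1, ?_⟩
  exact (collide_skew h).integrable_comp_of_integrable h1

lemma KacI_integrable (hB : IsKernel Bk Bsup) (h : i ≠ s) (hW : Integrable W) :
    Integrable (KacI Bk i s W) (sphMeasure.prod volume) := by
  obtain ⟨h1, h2⟩ := KacI_parts h hW
  have hb : Measurable (fun p : (Metric.sphere (0 : V3) 1) × Conf n =>
      Bk p.1 (p.2 i - p.2 s)) := by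
    have : Measurable (fun p : (Metric.sphere (0 : V3) 1) × Conf n =>
      ((p.1 : V3), (p.2 i - p.2 s))) := by fun_prop
    exact hB.1.comp this
  refine (h2.sub h1).bdd_mul (c := Bsup) hb.aestronglyMeasurable ?_
  refine Filter.Eventually.of_forall fun p => ?_
  rw [Real.norm_eq_abs, abs_of_nonneg (hB.2 _ _).1]
  exact (hB.2 _ _).2

lemma KacI_norm (hB : IsKernel Bk Bsup) (h : i ≠ s) (hW : Integrable W) :
    ∫ p, ‖KacI Bk i s W p‖ ∂(sphMeasure.prod volume) ≤ betaE Bsup * L1n W := by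
  obtain ⟨h1, h2⟩ := KacI_parts h hW
  have e1 : ∫ p : (Metric.sphere (0 : V3) 1) × Conf n, ‖W p.2‖ ∂(sphMeasure.prod volume)
      = sphMeasure.real Set.univ * L1n W := by
    have := integral_prod_mul (μ := sphMeasure) (ν := (volume : Measure (Conf n)))
      (fun _ => (1:ℝ)) (fun V => ‖W V‖)
    simpa [L1n] using this
  have e2 : ∫ p : (Metric.sphere (0 : V3) 1) × Conf n, ‖W (collideConf p.1 i s p.2)‖
      ∂(sphMeasure.prod volume) = sphMeasure.real Set.univ * L1n W := by
    rw [← e1]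
    have hs := collide_skew h
    conv_rhs => rw [← hs.map_eq]
    rw [integral_map hs.measurable.aemeasurable]
    rw [hs.map_eq]
    exact h1.norm.aestronglyMeasurable
  calc ∫ p, ‖KacI Bk i s W p‖ ∂(sphMeasure.prod volume)
      ≤ ∫ p : (Metric.sphere (0 : V3) 1) × Conf n,
        |Bsup| * (‖W (collideConf p.1 i s p.2)‖ + ‖W p.2‖) ∂(sphMeasure.prod volume) := by
        refine integral_mono (KacI_integrable hB h hW).norm ((h2.norm.add h1.norm).const_mul _) ?_
        intro p
        simp only [KacI, norm_mul]
        refine mul_le_mul ?_ (norm_sub_le _ _) (norm_nonneg _) (abs_nonneg _)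
        rw [Real.norm_eq_abs, abs_of_nonneg (hB.2 _ _).1]
        exact (hB.2 _ _).2.trans (le_abs_self _)
    _ = betaE Bsup * L1n W := by
        rw [integral_const_mul, integral_add h2.norm h1.norm, e1, e2]
        unfold betaE; ring

lemma KacT_eq (V : Conf n) : KacT Bk i s W V = ∫ ω, KacI Bk i s W (ω, V) ∂sphMeasure := rfl

lemma KacT_integrable (hB : IsKernel Bk Bsup) (h : i ≠ s) (hW : Integrable W) :
    Integrable (KacT Bk i s W) :=
  (KacI_integrable hB h hW).integral_prod_right

lemma KacT_L1 (hB : IsKernel Bk Bsup) (h : i ≠ s) (hW : Integrable W) :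
    L1n (KacT Bk i s W) ≤ betaE Bsup * L1n W := by
  refine le_trans ?_ (KacI_norm hB h hW)
  rw [integral_prod_symm (fun p => ‖KacI Bk i s W p‖) (KacI_integrable hB h hW).norm]
  refine integral_mono (KacT_integrable hB h hW).norm
    (KacI_integrable hB h hW).norm.integral_prod_right ?_
  intro V
  exact norm_integral_le_integral_norm (G := ℝ) _

lemma KacT_sum {ι : Type*} (S : Finset ι) (c : ι → ℝ) (Wf : ι → Conf n → ℝ)
    (hB : IsKernel Bk Bsup) (h : i ≠ s) (hW : ∀ k ∈ S, Integrable (Wf k)) :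
    KacT Bk i s (fun V => ∑ k ∈ S, c k * Wf k V) =ᵐ[volume]
      fun V => ∑ k ∈ S, c k * KacT Bk i s (Wf k) V := by
  have hae : ∀ᵐ V : Conf n, ∀ k ∈ S,
      Integrable (fun ω => KacI Bk i s (Wf k) (ω, V)) sphMeasure := by
    rw [Finset.eventually_all]
    exact fun k hk => (KacI_integrable hB h (hW k hk)).prod_left_ae
  filter_upwards [hae] with V hV
  simp only [KacT_eq, ← integral_const_mul]
  rw [← integral_finsetSum S (fun k hk => (hV k hk).const_mul _)]
  congr 1
  funext ω
  simp only [KacI, ← Finset.sum_sub_distrib, Finset.mul_sum]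
  refine Finset.sum_congr rfl fun k _ => by ring

end Kac

section Chi
variable {j : ℕ} {Bk : V3 → V3 → ℝ} {Bsup : ℝ} {i : Fin j} {g : Conf (j + 1) → ℝ}

lemma Chier_eq (V : Conf j) : Chier Bk i g V =
    ∫ u : V3, KacT Bk i.castSucc (Fin.last j) g (Fin.snoc V u : Conf (j+1)) := by
  simp only [Chier, KacT, collideConf]
  have h1 : ∀ u : V3, (Fin.snoc V u : Conf (j+1)) i.castSucc = V i := fun u => by simp
  have h2 : ∀ u : V3, (Fin.snoc V u : Conf (j+1)) (Fin.last j) = u := fun u => by simp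
  simp only [h1, h2]

/-- The map inserting a velocity at position `i` preserves volume. -/
lemma insert_mp (i : Fin (j+1)) :
    MeasurePreserving (fun p : V3 × Conf j => (i.insertNth p.1 p.2 : Conf (j+1)))
      (volume.prod volume) volume :=
  (volume_preserving_piFinSuccAbove (fun _ : Fin (j+1) => V3) i).symm

lemma insert_me (i : Fin (j+1)) :
    MeasurableEmbedding (fun p : V3 × Conf j => (i.insertNth p.1 p.2 : Conf (j+1))) :=
  (MeasurableEquiv.piFinSuccAbove (fun _ : Fin (j+1) => V3) i).symm.measurableEmbedding

lemma snoc_integrable (h : Integrable g) : Integrable (fun p : V3 × Conf j =>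
    g (Fin.snoc p.2 p.1 : Conf (j+1))) (volume.prod volume) := by
  have := (insert_mp (Fin.last j)).integrable_comp_of_integrable h
  simpa only [Function.comp_def, Fin.insertNth_last'] using this

lemma snoc_norm (g : Conf (j+1) → ℝ) : ∫ p : V3 × Conf j,
    ‖g (Fin.snoc p.2 p.1 : Conf (j+1))‖ ∂(volume.prod volume) = L1n g := by
  have := (insert_mp (Fin.last j)).integral_comp (insert_me _) (fun V => ‖g V‖)
  simp only [Fin.insertNth_last'] at this
  exact this

lemma Chier_integrable (hB : IsKernel Bk Bsup) (hg : Integrable g) :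
    Integrable (Chier Bk i g) := by
  have h := snoc_integrable (KacT_integrable (i := i.castSucc) (s := Fin.last j) hB
    (Fin.castSucc_ne_last i) hg)
  have := h.integral_prod_right
  refine this.congr (Filter.Eventually.of_forall fun V => (Chier_eq V).symm)

lemma Chier_L1 (hB : IsKernel Bk Bsup) (hg : Integrable g) :
    L1n (Chier Bk i g) ≤ betaE Bsup * L1n g := by
  have h := snoc_integrable (KacT_integrable (i := i.castSucc) (s := Fin.last j) hB
    (Fin.castSucc_ne_last i) hg)
  refine le_trans ?_ (KacT_L1 (i := i.castSucc) (s := Fin.last j) hB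
    (Fin.castSucc_ne_last i) hg)
  rw [← snoc_norm, integral_prod_symm (fun p : V3 × Conf j => ‖KacT Bk i.castSucc (Fin.last j) g
    (Fin.snoc p.2 p.1 : Conf (j+1))‖) h.norm]
  refine integral_mono (Chier_integrable hB hg).norm h.norm.integral_prod_right ?_
  intro V
  simp only [Chier_eq]
  exact norm_integral_le_integral_norm (G := ℝ) _

lemma Chier_sum {ι : Type*} (S : Finset ι) (c : ι → ℝ) (Wf : ι → Conf (j+1) → ℝ)
    (hB : IsKernel Bk Bsup) (hW : ∀ k ∈ S, Integrable (Wf k)) :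
    Chier Bk i (fun V => ∑ k ∈ S, c k * Wf k V) =ᵐ[volume]
      fun V => ∑ k ∈ S, c k * Chier Bk i (Wf k) V := by
  have hne := Fin.castSucc_ne_last i
  have hae : ∀ᵐ V : Conf j, ∀ k ∈ S,
      Integrable (fun u : V3 => KacT Bk i.castSucc (Fin.last j) (Wf k)
        (Fin.snoc V u : Conf (j+1))) := by
    rw [Finset.eventually_all]
    exact fun k hk => (snoc_integrable (KacT_integrable hB hne (hW k hk))).prod_left_ae
  have hs := KacT_sum S c Wf hB hne hW
  have hs2 := (insert_mp (Fin.last j)).quasiMeasurePreserving.ae hs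
  have hs3 := Measure.ae_ae_of_ae_prod (Measure.measurePreserving_swap (μ := (volume : Measure (Conf j)))
    (ν := (volume : Measure V3)) |>.quasiMeasurePreserving.ae hs2)
  filter_upwards [hae, hs3] with V hV hV2
  simp only [Chier_eq, ← integral_const_mul]
  rw [← integral_finsetSum S (fun k hk => (hV k hk).const_mul _)]
  refine integral_congr_ae ?_
  filter_upwards [hV2] with u hu
  simpa only [Prod.swap, Fin.insertNth_last'] using hu

end Chi

section Time

lemma joint_meas {X : Type*} [MeasurableSpace X] {m : Measure X} [SFinite m]
    (h h' : ℝ → X → ℝ)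
    (hd : ∀ t, 0 ≤ t → ∀ x, HasDerivAt (fun τ => h τ x) (h' t x) t)
    (hm : ∀ t, 0 ≤ t → AEStronglyMeasurable (h t) m) (T : ℝ) :
    AEMeasurable (fun p : X × ℝ => h' p.2 p.1) (m.prod (volume.restrict (Set.Icc 0 T))) := by
  classical
  -- exceptional set
  have hae : ∀ᵐ x ∂m, ∀ q : ℚ, (hq : (0:ℝ) ≤ q) → h q x = (hm q hq).mk _ x := by
    rw [ae_all_iff]
    intro q
    by_cases hq : (0:ℝ) ≤ q
    · filter_upwards [(hm q hq).ae_eq_mk] with x hx _ using hx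
    · exact Filter.Eventually.of_forall fun x hq' => absurd hq' hq
  obtain ⟨N, hNsub, hNm, hN0⟩ := exists_measurable_superset_of_null (ae_iff.1 hae)
  have hN : ∀ x ∉ N, ∀ q : ℚ, (hq : (0:ℝ) ≤ q) → h q x = (hm q hq).mk _ x := by
    intro x hx
    by_contra hcon
    exact hx (hNsub hcon)
  let k : ℝ → X → ℝ := fun t => Nᶜ.indicator (h (max t 0))
  have hkc : ∀ x, Continuous fun t => k t x := by
    intro x
    by_cases hx : x ∈ N
    · have : (fun t => k t x) = fun _ => 0 := by
        funext t; simp [k, hx]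
      rw [this]; exact continuous_const
    · have : (fun t => k t x) = fun t => h (max t 0) x := by
        funext t; simp [k, hx]
      rw [this]
      rw [continuous_iff_continuousAt]
      intro t
      exact ContinuousAt.comp (f := fun t => max t 0) (g := fun τ => h τ x)
        (hd _ (le_max_right _ _) x).continuousAt (by fun_prop)
  have hkq : ∀ q : ℚ, (0:ℝ) ≤ q → Measurable (k q) := by
    intro q hq
    have : k q = Nᶜ.indicator ((hm q hq).mk _) := by
      funext x
      by_cases hx : x ∈ N
      · simp [k, hx]
      · simp [k, hx, max_eq_left hq, hN x hx q hq]
    rw [this]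
    exact (hm q hq).stronglyMeasurable_mk.measurable.indicator hNm.compl
  have hkm : ∀ t, Measurable (k t) := by
    intro t
    have hmx : k t = k (max t 0) := by
      funext x; simp [k]
    rw [hmx]
    have hex : ∀ n : ℕ, ∃ q : ℚ, max t 0 < q ∧ (q:ℝ) < max t 0 + 1 / ((n:ℝ) + 1) := by
      intro n
      exact exists_rat_btwn (by linarith [Nat.one_div_pos_of_nat (α := ℝ) (n := n)])
    choose q hq1 hq2 using hex
    have hqt : Filter.Tendsto (fun n => (q n : ℝ)) Filter.atTop (nhds (max t 0)) := by
      refine tendsto_of_tendsto_of_tendsto_of_le_of_le tendsto_const_nhds ?_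
        (fun n => (hq1 n).le) (fun n => (hq2 n).le)
      simpa using tendsto_const_nhds.add (tendsto_one_div_add_atTop_nhds_zero_nat (𝕜 := ℝ))
    refine measurable_of_tendsto_metrizable (f := fun n => k (q n))
      (fun n => hkq _ ((le_max_right t 0).trans (hq1 n).le)) ?_
    rw [tendsto_pi_nhds]
    intro x
    exact ((hkc x).tendsto _).comp hqt
  have hjoint : Measurable (fun p : ℝ × X => k p.1 p.2) :=
    measurable_uncurry_of_continuous_of_measurable hkc hkm
  let dq : ℕ → X × ℝ → ℝ := fun n p =>
    ((n:ℝ) + 1) * (k (p.2 + 1 / ((n:ℝ)+1)) p.1 - k p.2 p.1)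
  have hdq : ∀ n, Measurable (dq n) := by
    intro n
    have e1 : Measurable (fun p : X × ℝ => k (p.2 + 1 / ((n:ℝ)+1)) p.1) :=
      hjoint.comp (g := fun p : ℝ × X => k p.1 p.2)
        (f := fun p : X × ℝ => (p.2 + 1 / ((n:ℝ)+1), p.1)) (by fun_prop)
    have e2 : Measurable (fun p : X × ℝ => k p.2 p.1) :=
      hjoint.comp (g := fun p : ℝ × X => k p.1 p.2)
        (f := fun p : X × ℝ => (p.2, p.1)) (by fun_prop)
    exact (e1.sub e2).const_mul _
  refine aemeasurable_of_tendsto_metrizable_ae Filter.atTop (f := dq)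
    (fun n => (hdq n).aemeasurable) ?_
  have hA : ∀ᵐ p : X × ℝ ∂(m.prod (volume.restrict (Set.Icc 0 T))), p.1 ∉ N :=
    Measure.quasiMeasurePreserving_fst.ae (measure_eq_zero_iff_ae_notMem.1 hN0)
  have hB : ∀ᵐ p : X × ℝ ∂(m.prod (volume.restrict (Set.Icc 0 T))), p.2 ∈ Set.Icc 0 T :=
    Measure.quasiMeasurePreserving_snd.ae (ae_restrict_mem measurableSet_Icc)
  filter_upwards [hA, hB] with p hp1 hp2
  have hder := hd p.2 hp2.1 p.1
  have hlim := hder.tendsto_slope_zero_right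
  have hseq : Filter.Tendsto (fun n : ℕ => 1 / ((n:ℝ)+1)) Filter.atTop (nhdsWithin 0 (Set.Ioi 0)) := by
    rw [tendsto_nhdsWithin_iff]
    exact ⟨tendsto_one_div_add_atTop_nhds_zero_nat,
      Filter.Eventually.of_forall fun n => Set.mem_Ioi.2 Nat.one_div_pos_of_nat⟩
  refine (hlim.comp hseq).congr fun n => ?_
  have hpos : (0:ℝ) < 1 / ((n:ℝ)+1) := Nat.one_div_pos_of_nat
  simp only [Function.comp, dq, k, smul_eq_mul]
  rw [Set.indicator_of_mem (by exact hp1), Set.indicator_of_mem (by exact hp1),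
    max_eq_left hp2.1, max_eq_left (by linarith [hp2.1])]
  simp

lemma time_bound {X : Type*} [MeasurableSpace X] {m : Measure X} [SFinite m]
    (h h' : ℝ → X → ℝ)
    (hd : ∀ t, 0 ≤ t → ∀ x, HasDerivAt (fun τ => h τ x) (h' t x) t)
    (hi : ∀ t, 0 ≤ t → Integrable (h t) m) (T : ℝ) (hT : 0 ≤ T)
    (G g : ℝ → ℝ) (hG : ∀ t, 0 ≤ t → t ≤ T → HasDerivAt G (g t) t)
    (hgc : ContinuousOn g (Set.Icc 0 T))
    (hb : ∀ t, 0 ≤ t → t ≤ T → Integrable (h' t) m ∧ ∫ x, |h' t x| ∂m ≤ g t) :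
    ∫ x, |h T x| ∂m ≤ ∫ x, |h 0 x| ∂m + (G T - G 0) := by
  have hjm := joint_meas h h' hd (fun t ht => (hi t ht).aestronglyMeasurable) T
  have hpt : ∀ x, ENNReal.ofReal |h T x - h 0 x| ≤ ∫⁻ s in Set.Icc 0 T, ‖h' s x‖ₑ := by
    intro x
    by_cases htop : ∫⁻ s in Set.Icc 0 T, ‖h' s x‖ₑ = ⊤
    · rw [htop]; exact le_top
    · have hmeas : AEStronglyMeasurable (fun s => h' s x) (volume.restrict (Set.Icc 0 T)) := by
        refine (measurable_deriv (fun τ => h τ x)).aestronglyMeasurable.congr ?_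
        filter_upwards [ae_restrict_mem measurableSet_Icc] with s hs
        exact (hd s hs.1 x).deriv
      have hint : IntegrableOn (fun s => h' s x) (Set.Icc 0 T) :=
        ⟨hmeas, lt_top_iff_ne_top.2 htop⟩
      have hii : IntervalIntegrable (fun s => h' s x) volume 0 T := by
        rw [intervalIntegrable_iff_integrableOn_Icc_of_le hT]; exact hint
      have hftc := intervalIntegral.integral_eq_sub_of_hasDerivAt (f := fun τ => h τ x)
        (f' := fun s => h' s x) (a := 0) (b := T) (fun s hs => by
          rw [Set.uIcc_of_le hT] at hs
          exact hd s hs.1 x) hii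
      rw [← hftc, intervalIntegral.integral_of_le hT, ← integral_Icc_eq_integral_Ioc]
      rw [← Real.enorm_eq_ofReal_abs]
      exact enorm_integral_le_lintegral_enorm _
  have hgint : IntervalIntegrable g volume 0 T :=
    ContinuousOn.intervalIntegrable (by rwa [Set.uIcc_of_le hT])
  have hgI : ∫ s in (0:ℝ)..T, g s = G T - G 0 :=
    intervalIntegral.integral_eq_sub_of_hasDerivAt (fun s hs => by
      rw [Set.uIcc_of_le hT] at hs
      exact hG s hs.1 hs.2) hgint
  have hg0 : ∀ s ∈ Set.Icc 0 T, 0 ≤ g s := fun s hs =>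
    (integral_nonneg fun x => abs_nonneg _).trans (hb s hs.1 hs.2).2
  have hdiff : ENNReal.ofReal (∫ x, |h T x - h 0 x| ∂m) ≤ ENNReal.ofReal (G T - G 0) := by
    have e1 : ENNReal.ofReal (∫ x, |h T x - h 0 x| ∂m)
        = ∫⁻ x, ENNReal.ofReal |h T x - h 0 x| ∂m :=
      ofReal_integral_eq_lintegral_ofReal ((hi T hT).sub (hi 0 le_rfl)).abs
        (Filter.Eventually.of_forall fun x => abs_nonneg _)
    rw [e1]
    calc ∫⁻ x, ENNReal.ofReal |h T x - h 0 x| ∂m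
        ≤ ∫⁻ x, (∫⁻ s in Set.Icc 0 T, ‖h' s x‖ₑ) ∂m := lintegral_mono hpt
      _ = ∫⁻ s in Set.Icc 0 T, (∫⁻ x, ‖h' s x‖ₑ ∂m) :=
          lintegral_lintegral_swap (f := fun x s => ‖h' s x‖ₑ) hjm.enorm
      _ ≤ ∫⁻ s in Set.Icc 0 T, ENNReal.ofReal (g s) := by
          refine setLIntegral_mono' measurableSet_Icc fun s hs => ?_
          rw [← ofReal_integral_norm_eq_lintegral_enorm (hb s hs.1 hs.2).1]
          exact ENNReal.ofReal_le_ofReal (hb s hs.1 hs.2).2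
      _ = ENNReal.ofReal (G T - G 0) := by
          rw [← hgI, intervalIntegral.integral_of_le hT, ← integral_Icc_eq_integral_Ioc]
          refine (ofReal_integral_eq_lintegral_ofReal ?_ ?_).symm
          · exact (intervalIntegrable_iff_integrableOn_Icc_of_le hT).1 hgint
          · filter_upwards [ae_restrict_mem measurableSet_Icc] with s hs using hg0 s hs
  have hGn : 0 ≤ G T - G 0 := by
    rw [← hgI]
    exact intervalIntegral.integral_nonneg hT hg0
  have hdiff' := (ENNReal.ofReal_le_ofReal_iff hGn).1 hdiff
  have : ∫ x, |h T x| ∂m ≤ ∫ x, (|h 0 x| + |h T x - h 0 x|) ∂m := by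
    refine integral_mono (hi T hT).abs ((hi 0 le_rfl).abs.add ((hi T hT).sub (hi 0 le_rfl)).abs) ?_
    intro x
    have := abs_add_le (h 0 x) (h T x - h 0 x)
    simpa using this
  have hadd : ∫ x, (|h 0 x| + |h T x - h 0 x|) ∂m
      = ∫ x, |h 0 x| ∂m + ∫ x, |h T x - h 0 x| ∂m :=
    integral_add (hi 0 le_rfl).abs ((hi T hT).sub (hi 0 le_rfl)).abs
  linarith

end Time

section Comb

/-- A single term `f^μ_A f^{⊗ Aᶜ}`. -/
def Fterm (fam : ∀ k : ℕ, Conf k → ℝ) (f : V3 → ℝ) {n : ℕ} (A : Finset (Fin n)) : Conf n → ℝ :=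
  fun V => evalAt fam A V * ∏ i ∈ Aᶜ, f (V i)

/-- The sign attached to a subset. -/
def sg {n : ℕ} (A : Finset (Fin n)) : ℝ := (-1 : ℝ) ^ Aᶜ.card

variable (fam : ∀ k : ℕ, Conf k → ℝ) (f : V3 → ℝ)

lemma corrErr_eq {n : ℕ} (V : Conf n) :
    corrErr fam f n V = ∑ A : Finset (Fin n), sg A * Fterm fam f A V := by
  unfold corrErr sg Fterm
  refine Fintype.sum_bijective (fun A : Finset (Fin n) => Aᶜ) compl_bijective _ _ fun K => ?_
  simp only [compl_compl, evalAt, mul_assoc]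

lemma evalAt_strictMono {n k : ℕ} (e : Fin k → Fin n) (he : StrictMono e) (A : Finset (Fin n))
    (hA : Finset.univ.image e = A) (V : Conf n) : evalAt fam A V = fam k (V ∘ e) := by
  have hc : A.card = k := by
    rw [← hA, Finset.card_image_of_injective _ he.injective, Finset.card_univ, Fintype.card_fin]
  subst hc
  have : e = A.orderEmbOfFin rfl := Finset.orderEmbOfFin_unique rfl (fun x => hA.subset
    (Finset.mem_image_of_mem _ (Finset.mem_univ _))) he
  rw [this]
  rfl

lemma evalAt_map {m n : ℕ} (e : Fin m ↪ Fin n) (he : StrictMono e) (A : Finset (Fin m))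
    (V : Conf n) : evalAt fam (A.map e) V = evalAt fam A (V ∘ e) := by
  rw [evalAt_strictMono fam (e ∘ A.orderEmbOfFin rfl)
    (he.comp (A.orderEmbOfFin rfl).strictMono) (A.map e) ?_ V]
  · rfl
  · rw [← Finset.image_image, Finset.image_orderEmbOfFin_univ, Finset.map_eq_image]

lemma prod_compl {n : ℕ} (A : Finset (Fin n)) (g : Fin n → ℝ) :
    ∏ i ∈ Aᶜ, g i = ∏ i, if i ∈ A then 1 else g i := by
  rw [Finset.prod_ite, Finset.prod_const_one, one_mul]
  congr 1
  ext i; simp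

lemma Fterm_insert {m : ℕ} (i : Fin (m+1)) (A : Finset (Fin m)) (u : V3) (V : Conf m) :
    Fterm fam f (A.map i.succAboveEmb) (i.insertNth u V : Conf (m+1)) = f u * Fterm fam f A V := by
  unfold Fterm
  rw [evalAt_map fam i.succAboveEmb (Fin.strictMono_succAbove i), prod_compl, prod_compl,
    Fin.prod_univ_succAbove _ i]
  have h1 : (i.insertNth u V : Conf (m+1)) ∘ i.succAboveEmb = V := by
    funext k; simp
  rw [h1]
  have h2 : i ∉ A.map i.succAboveEmb := by simp [Fin.succAbove_ne]
  simp only [h2, if_false, Fin.insertNth_apply_same, Fin.insertNth_apply_succAbove]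
  have h3 : ∀ k : Fin m, (i.succAbove k ∈ A.map i.succAboveEmb) ↔ k ∈ A := by
    intro k; simp
  simp only [h3]
  ring

lemma sg_map {m : ℕ} (i : Fin (m+1)) (A : Finset (Fin m)) :
    sg (A.map i.succAboveEmb) = - sg A := by
  unfold sg
  have h := Finset.card_compl (A.map i.succAboveEmb)
  have h' := Finset.card_compl A
  have hle := Finset.card_le_univ A
  simp only [Finset.card_map, Fintype.card_fin] at h h' hle
  rw [h, h', Nat.succ_sub hle, pow_succ]
  ring

lemma sg_insert_map {m : ℕ} (i : Fin (m+1)) (A : Finset (Fin m)) :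
    sg (insert i (A.map i.succAboveEmb)) = sg A := by
  unfold sg
  have h2 : i ∉ A.map i.succAboveEmb := by simp [Fin.succAbove_ne]
  rw [Finset.card_compl, Finset.card_compl, Finset.card_insert_of_notMem h2, Finset.card_map]
  simp

lemma filter_notMem {m : ℕ} (i : Fin (m+1)) :
    (Finset.univ.filter fun A : Finset (Fin (m+1)) => i ∉ A)
      = Finset.univ.map (Finset.mapEmbedding i.succAboveEmb).toEmbedding := by
  ext A
  simp only [Finset.mem_filter, Finset.mem_univ, true_and, Finset.mem_map]
  constructor
  · intro h
    refine ⟨Finset.univ.filter fun k => i.succAbove k ∈ A, ?_⟩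
    ext k
    simp only [RelEmbedding.coe_toEmbedding, Finset.mapEmbedding_apply, Finset.mem_map,
      Finset.mem_filter, Finset.mem_univ, true_and, Fin.coe_succAboveEmb]
    constructor
    · rintro ⟨a, ha, rfl⟩; exact ha
    · intro hk
      have : k ≠ i := fun h' => h (h' ▸ hk)
      obtain ⟨a, rfl⟩ := Fin.exists_succAbove_eq this
      exact ⟨a, hk, rfl⟩
  · rintro ⟨B, rfl⟩
    simp [Fin.succAbove_ne]

lemma sum_notMem {m : ℕ} (i : Fin (m+1)) (c : Finset (Fin (m+1)) → ℝ) :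
    ∑ A with i ∉ A, c A = ∑ A : Finset (Fin m), c (A.map i.succAboveEmb) := by
  rw [filter_notMem, Finset.sum_map]
  rfl

lemma sum_split {m : ℕ} (i : Fin (m+1)) (c : Finset (Fin (m+1)) → ℝ) :
    ∑ A, c A = ∑ A : Finset (Fin m), c (A.map i.succAboveEmb)
      + ∑ A : Finset (Fin m), c (insert i (A.map i.succAboveEmb)) := by
  have hu : (Finset.univ : Finset (Finset (Fin (m+1)))) = (insert i ({i}ᶜ) : Finset (Fin (m+1))).powerset := by
    ext A; simp only [Finset.mem_univ, Finset.mem_powerset, true_iff]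
    intro k _
    by_cases hk : k = i <;> simp [hk]
  have hp : ({i}ᶜ : Finset (Fin (m+1))).powerset = Finset.univ.filter (fun A => i ∉ A) := by
    ext A; simp [Finset.mem_powerset, Finset.subset_compl_singleton]
  rw [hu, Finset.sum_powerset_insert (by simp), hp, sum_notMem,
    sum_notMem i (fun A => c (insert i A))]

section Dens
variable {fam f}

lemma insert_integrable {m : ℕ} (i : Fin (m+1)) {G : Conf (m+1) → ℝ} {H : Conf m → ℝ} {c : ℝ}
    (hf : Integrable f) (hH : Integrable H)
    (h : ∀ u V, G (i.insertNth u V) = c * (f u * H V)) : Integrable G := by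
  have h1 : Integrable (fun p : V3 × Conf m => f p.1 * H p.2) (volume.prod volume) :=
    hf.mul_prod hH
  rw [← (insert_mp i).integrable_comp_emb (insert_me i)]
  refine (h1.const_mul c).congr (Filter.Eventually.of_forall fun p => ?_)
  simp only [Function.comp, h]

lemma insert_L1 {m : ℕ} (i : Fin (m+1)) {G : Conf (m+1) → ℝ} {H : Conf m → ℝ} {c : ℝ}
    (hc : |c| = 1) (hf0 : ∀ v, 0 ≤ f v) (hf1 : ∫ v, f v = 1)
    (h : ∀ u V, G (i.insertNth u V) = c * (f u * H V)) : L1n G = L1n H := by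
  unfold L1n
  rw [← (insert_mp i).integral_comp (insert_me i)]
  have : ∀ p : V3 × Conf m, |G (i.insertNth p.1 p.2 : Conf (m+1))| = f p.1 * |H p.2| := by
    intro p
    rw [h, abs_mul, hc, one_mul, abs_mul, abs_of_nonneg (hf0 _)]
  simp only [this]
  rw [integral_prod_mul (fun v => f v) (fun V => |H V|), hf1, one_mul]

lemma Fterm_univ {n : ℕ} : Fterm fam f (Finset.univ : Finset (Fin n)) = fam n := by
  funext V
  unfold Fterm
  rw [evalAt_strictMono fam (id : Fin n → Fin n) strictMono_id _ (by simp)]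
  simp

lemma Fterm_good (hfam : ∀ k, Integrable (fam k) ∧ L1n (fam k) = 1) (hf0 : ∀ v, 0 ≤ f v)
    (hfi : Integrable f) (hf1 : ∫ v, f v = 1) :
    ∀ {n : ℕ} (A : Finset (Fin n)), Integrable (Fterm fam f A) ∧ L1n (Fterm fam f A) = 1 := by
  intro n
  induction n with
  | zero =>
    intro A
    have : A = Finset.univ := Subsingleton.elim _ _
    rw [this, Fterm_univ]
    exact hfam 0
  | succ m ih =>
    intro A
    by_cases hA : A = Finset.univ
    · rw [hA, Fterm_univ]; exact hfam _
    · have : ∃ i, i ∉ A := by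
        by_contra hcon
        push Not at hcon
        exact hA (Finset.eq_univ_iff_forall.2 hcon)
      obtain ⟨i, hi⟩ := this
      have hmem : A ∈ Finset.univ.filter fun A : Finset (Fin (m+1)) => i ∉ A := by simp [hi]
      rw [filter_notMem, Finset.mem_map] at hmem
      obtain ⟨B, -, hB⟩ := hmem
      have hB' : B.map i.succAboveEmb = A := hB
      rw [← hB']
      have key : ∀ u V, Fterm fam f (B.map i.succAboveEmb) (i.insertNth u V : Conf (m+1))
          = 1 * (f u * Fterm fam f B V) := fun u V => by rw [Fterm_insert, one_mul]
      exact ⟨insert_integrable i hfi (ih B).1 key,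
        (insert_L1 i (by simp) hf0 hf1 key).trans (ih B).2⟩

lemma sum_L1_le {n : ℕ} {G H : Conf n → ℝ} (hG : Integrable G) (hH : Integrable H) :
    L1n (fun V => G V + H V) ≤ L1n G + L1n H := by
  unfold L1n
  rw [← integral_add hG.abs hH.abs]
  exact integral_mono (hG.add hH).abs (hG.abs.add hH.abs) fun V => abs_add_le _ _

lemma smul_L1 {n : ℕ} (c : ℝ) (G : Conf n → ℝ) : L1n (fun V => c * G V) = |c| * L1n G := by
  unfold L1n
  simp only [abs_mul, integral_const_mul]

lemma finsum_L1_le {n : ℕ} {ι : Type*} (S : Finset ι) (G : ι → Conf n → ℝ)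
    (hG : ∀ k ∈ S, Integrable (G k)) :
    L1n (fun V => ∑ k ∈ S, G k V) ≤ ∑ k ∈ S, L1n (G k) := by
  unfold L1n
  rw [← integral_finsetSum _ fun k hk => (hG k hk).abs]
  exact integral_mono (integrable_finsetSum _ hG).abs
    (integrable_finsetSum _ fun k hk => (hG k hk).abs) fun V => Finset.abs_sum_le_sum_abs _ _

/-- Signed sum over a collection of subsets. -/
def Psum (fam : ∀ k : ℕ, Conf k → ℝ) (f : V3 → ℝ) {n : ℕ} (S : Finset (Finset (Fin n))) :
    Conf n → ℝ := fun V => ∑ A ∈ S, sg A * Fterm fam f A V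

lemma sg_abs {n : ℕ} (A : Finset (Fin n)) : |sg A| = 1 := by simp [sg, abs_pow]

lemma corrErr_Psum {n : ℕ} : corrErr fam f n = Psum fam f Finset.univ := by
  funext V; exact corrErr_eq fam f V

lemma Psum_integrable (hfam : ∀ k, Integrable (fam k) ∧ L1n (fam k) = 1) (hf0 : ∀ v, 0 ≤ f v)
    (hfi : Integrable f) (hf1 : ∫ v, f v = 1)
    {n : ℕ} (S : Finset (Finset (Fin n))) : Integrable (Psum fam f S) :=
  integrable_finsetSum _ fun A _ => (Fterm_good hfam hf0 hfi hf1 A).1.const_mul _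

lemma corrErr_integrable (hfam : ∀ k, Integrable (fam k) ∧ L1n (fam k) = 1) (hf0 : ∀ v, 0 ≤ f v)
    (hfi : Integrable f) (hf1 : ∫ v, f v = 1)
    (n : ℕ) : Integrable (corrErr fam f n) := by
  rw [corrErr_Psum]; exact Psum_integrable hfam hf0 hfi hf1 _

lemma corrErr_le (hfam : ∀ k, Integrable (fam k) ∧ L1n (fam k) = 1) (hf0 : ∀ v, 0 ≤ f v)
    (hfi : Integrable f) (hf1 : ∫ v, f v = 1)
    (n : ℕ) : L1n (corrErr fam f n) ≤ 2 ^ n := by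
  rw [corrErr_Psum]
  refine (finsum_L1_le _ _ fun A _ => (Fterm_good hfam hf0 hfi hf1 A).1.const_mul _).trans ?_
  simp only [smul_L1, sg_abs, (Fterm_good hfam hf0 hfi hf1 _).2]
  simp

lemma Psum_not1 (hf0 : ∀ v, 0 ≤ f v) (hf1 : ∫ v, f v = 1) {m : ℕ} (i : Fin (m+1)) :
    L1n (Psum fam f (Finset.univ.filter fun A => i ∉ A)) = L1n (corrErr fam f m) := by
  refine insert_L1 (f := f) i (c := -1) (by simp) hf0 hf1 fun u V => ?_
  unfold Psum
  rw [sum_notMem i (fun A => sg A * Fterm fam f A (i.insertNth u V : Conf (m+1))), corrErr_eq]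
  simp only [sg_map, Fterm_insert, Finset.mul_sum]
  exact Finset.sum_congr rfl fun A _ => by ring

lemma Psum_not2 (hf0 : ∀ v, 0 ≤ f v) (hf1 : ∫ v, f v = 1) {m : ℕ} (i s : Fin (m+2)) (h : i ≠ s) :
    L1n (Psum fam f (Finset.univ.filter fun A => i ∉ A ∧ s ∉ A)) = L1n (corrErr fam f m) := by
  obtain ⟨s', rfl⟩ := Fin.exists_succAbove_eq h.symm
  rw [← Psum_not1 (fam := fam) hf0 hf1 s']
  refine insert_L1 (f := f) i (c := -1) (by simp) hf0 hf1 fun u V => ?_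
  unfold Psum
  rw [← Finset.filter_filter, Finset.sum_filter,
    sum_notMem i (fun A => if i.succAbove s' ∉ A then
      sg A * Fterm fam f A (i.insertNth u V : Conf (m+2)) else 0), ← Finset.sum_filter]
  have h3 : ∀ A : Finset (Fin (m+1)), (i.succAbove s' ∉ A.map i.succAboveEmb) ↔ s' ∉ A := by
    intro A; simp
  simp only [sg_map, Fterm_insert, Finset.mul_sum, h3]
  exact Finset.sum_congr rfl fun A _ => by ring

lemma Psum_both (hfam : ∀ k, Integrable (fam k) ∧ L1n (fam k) = 1) (hf0 : ∀ v, 0 ≤ f v)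
    (hfi : Integrable f) (hf1 : ∫ v, f v = 1)
    {m : ℕ} (i s : Fin (m+2)) (h : i ≠ s) :
    L1n (Psum fam f (Finset.univ.filter fun A => i ∈ A ∧ s ∈ A)) ≤
      L1n (corrErr fam f (m+2)) + 2 * L1n (corrErr fam f (m+1)) + L1n (corrErr fam f m) := by
  have key : Psum fam f (Finset.univ.filter fun A => i ∈ A ∧ s ∈ A) = fun V =>
      (corrErr fam f (m+2) V + (-1) * Psum fam f (Finset.univ.filter fun A => i ∉ A) V)
      + ((-1) * Psum fam f (Finset.univ.filter fun A => s ∉ A) V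
      + Psum fam f (Finset.univ.filter fun A => i ∉ A ∧ s ∉ A) V) := by
    funext V
    rw [corrErr_eq]
    simp only [Psum, Finset.sum_filter, Finset.mul_sum, ← Finset.sum_add_distrib]
    refine Finset.sum_congr rfl fun A _ => ?_
    by_cases h1 : i ∈ A <;> by_cases h2 : s ∈ A <;> simp [h1, h2]
  have I := fun S : Finset (Finset (Fin (m+2))) => Psum_integrable hfam hf0 hfi hf1 S
  have I0 := corrErr_integrable hfam hf0 hfi hf1 (m+2)
  rw [key]
  refine (sum_L1_le (I0.add ((I _).const_mul _)) (((I _).const_mul _).add (I _))).trans ?_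
  refine (add_le_add (sum_L1_le I0 ((I _).const_mul _)) (sum_L1_le ((I _).const_mul _) (I _))).trans ?_
  rw [smul_L1, smul_L1, Psum_not1 hf0 hf1, Psum_not1 hf0 hf1, Psum_not2 hf0 hf1 i s h]
  simp
  linarith

/-- Extension of `A` for the action of `C_{i,j+1}`. -/
def extA {j : ℕ} (i : Fin j) (A : Finset (Fin j)) : Finset (Fin (j+1)) :=
  if i ∈ A then insert (Fin.last j) (A.map (Fin.last j).succAboveEmb)
    else A.map (Fin.last j).succAboveEmb

lemma Pext (hfam : ∀ k, Integrable (fam k) ∧ L1n (fam k) = 1) (hf0 : ∀ v, 0 ≤ f v)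
    (hfi : Integrable f) (hf1 : ∫ v, f v = 1)
    {j : ℕ} (i : Fin j) :
    L1n (fun V => ∑ A : Finset (Fin j), sg A * Fterm fam f (extA i A) V) ≤
      L1n (corrErr fam f (j+1)) + 2 * L1n (corrErr fam f j) := by
  have key : (fun V => ∑ A : Finset (Fin j), sg A * Fterm fam f (extA i A) V) = fun V =>
      (corrErr fam f (j+1) V + (-1) * Psum fam f (Finset.univ.filter fun A => Fin.last j ∉ A) V)
      + (-1) * Psum fam f (Finset.univ.filter fun A => i.castSucc ∉ A) V := by
    funext V
    rw [corrErr_eq]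
    unfold Psum
    rw [Finset.sum_filter (fun A => i.castSucc ∉ A), sum_notMem (Fin.last j)
        (fun A => sg A * Fterm fam f A V),
      sum_split (Fin.last j) (fun A => sg A * Fterm fam f A V),
      sum_split (Fin.last j) (fun A => if i.castSucc ∉ A then sg A * Fterm fam f A V else 0)]
    simp only [Finset.mul_sum, ← Finset.sum_add_distrib]
    refine Finset.sum_congr rfl fun A _ => ?_
    have h1 : i.castSucc ∈ A.map (Fin.last j).succAboveEmb ↔ i ∈ A := by
      simp
    have h2 : i.castSucc ∈ insert (Fin.last j) (A.map (Fin.last j).succAboveEmb) ↔ i ∈ A := by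
      rw [Finset.mem_insert, h1]
      simp [Fin.castSucc_ne_last]
    simp only [h1, h2, sg_map, sg_insert_map, extA]
    by_cases h : i ∈ A <;> simp [h]
  have I := fun S : Finset (Finset (Fin (j+1))) => Psum_integrable hfam hf0 hfi hf1 S
  have I0 := corrErr_integrable hfam hf0 hfi hf1 (j+1)
  rw [key]
  refine (sum_L1_le (I0.add ((I _).const_mul _)) ((I _).const_mul _)).trans ?_
  refine (add_le_add (sum_L1_le I0 ((I _).const_mul _)) le_rfl).trans ?_
  rw [smul_L1, smul_L1, Psum_not1 hf0 hf1, Psum_not1 hf0 hf1]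
  simp
  linarith

end Dens
end Comb

section Deriv

lemma evalAt_congr (fam : ∀ k : ℕ, Conf k → ℝ) {n : ℕ} (A : Finset (Fin n)) {V W : Conf n}
    (h : ∀ k ∈ A, V k = W k) : evalAt fam A V = evalAt fam A W := by
  unfold evalAt
  congr 1
  funext a
  exact h _ (A.orderIsoOfFin rfl a).2

lemma collideConf_comp {n k : ℕ} (e : Fin k → Fin n) (he : Function.Injective e) (ω : V3)
    (a b : Fin k) (V : Conf n) :
    collideConf ω (e a) (e b) V ∘ e = collideConf ω a b (V ∘ e) := by
  unfold collideConf
  rw [Function.update_comp_eq_of_injective _ he, Function.update_comp_eq_of_injective _ he]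
  rfl

variable (fam : ∀ k : ℕ, Conf k → ℝ) (f : V3 → ℝ) (Bk : V3 → V3 → ℝ)

lemma KacT_Fterm {n k : ℕ} (e : Fin k → Fin n) (he : StrictMono e) (A : Finset (Fin n))
    (hA : Finset.univ.image e = A) (a b : Fin k) (V : Conf n) :
    KacT Bk (e a) (e b) (Fterm fam f A) V
      = KacT Bk a b (fam k) (V ∘ e) * ∏ i ∈ Aᶜ, f (V i) := by
  unfold KacT
  rw [← integral_mul_const]
  congr 1
  funext ω
  unfold Fterm
  rw [evalAt_strictMono fam e he A hA, evalAt_strictMono fam e he A hA,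
    collideConf_comp e he.injective]
  have hmem : ∀ c, e c ∈ A := fun c => hA.subset (Finset.mem_image_of_mem _ (Finset.mem_univ _))
  have : ∏ i ∈ Aᶜ, f (collideConf (ω : V3) (e a) (e b) V i) = ∏ i ∈ Aᶜ, f (V i) := by
    refine Finset.prod_congr rfl fun i hi => ?_
    rw [Finset.mem_compl] at hi
    rw [collideConf_apply_o _ (fun h : i = e a => hi (by rw [h]; exact hmem a))
      (fun h : i = e b => hi (by rw [h]; exact hmem b))]
  rw [this]
  simp only [Function.comp]
  ring

lemma KacTn_Fterm {n : ℕ} (A : Finset (Fin n)) (V : Conf n) :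
    evalAt (fun k => KacTn Bk (fam k)) A V * ∏ i ∈ Aᶜ, f (V i) =
      ∑ i : Fin n, ∑ s : Fin n, if i < s then
        (if i ∈ A ∧ s ∈ A then KacT Bk i s (Fterm fam f A) V else 0) else 0 := by
  set e := A.orderEmbOfFin rfl with he
  have himg : Finset.univ.image e = A := Finset.image_orderEmbOfFin_univ A rfl
  have hre : ∀ g : Fin n → ℝ, (∑ i, if i ∈ A then g i else 0) = ∑ a, g (e a) := by
    intro g
    rw [← Finset.sum_filter, Finset.filter_mem_eq_inter, Finset.univ_inter]
    conv_lhs => rw [← himg]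
    rw [Finset.sum_image (fun x _ y _ h => e.injective h)]
  have h1 : ∀ i s : Fin n, (if i < s then
        (if i ∈ A ∧ s ∈ A then KacT Bk i s (Fterm fam f A) V else 0) else 0)
      = if i ∈ A then (if s ∈ A then (if i < s then KacT Bk i s (Fterm fam f A) V else 0) else 0)
        else 0 := by
    intro i s
    by_cases h1 : i < s <;> by_cases h2 : i ∈ A <;> by_cases h3 : s ∈ A <;> simp [h1, h2, h3]
  have h2 : ∀ i : Fin n, (∑ s : Fin n, if i < s then
        (if i ∈ A ∧ s ∈ A then KacT Bk i s (Fterm fam f A) V else 0) else 0)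
      = if i ∈ A then (∑ b, if i < e b then KacT Bk i (e b) (Fterm fam f A) V else 0) else 0 := by
    intro i
    simp only [h1]
    by_cases h2 : i ∈ A
    · simp only [h2, if_true]
      exact hre _
    · simp [h2]
  simp only [h2]
  rw [hre (fun i => ∑ b, if i < e b then KacT Bk i (e b) (Fterm fam f A) V else 0)]
  rw [evalAt_strictMono _ e e.strictMono A himg]
  unfold KacTn
  rw [Finset.sum_mul]
  refine Finset.sum_congr rfl fun a _ => ?_
  rw [Finset.sum_mul]
  refine Finset.sum_congr rfl fun b _ => ?_
  rw [KacT_Fterm fam f Bk e e.strictMono A himg]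
  simp only [e.lt_iff_lt]
  split_ifs <;> simp

lemma snocE_strictMono {j k : ℕ} (e : Fin k → Fin j) (he : StrictMono e) :
    StrictMono (Fin.snoc (fun a => (e a).castSucc) (Fin.last j) : Fin (k+1) → Fin (j+1)) := by
  intro a b hab
  induction b using Fin.lastCases with
  | last =>
    induction a using Fin.lastCases with
    | last => exact absurd hab (lt_irrefl _)
    | cast a => simp
  | cast b =>
    induction a using Fin.lastCases with
    | last => exact absurd hab (not_lt.2 (Fin.le_last _))
    | cast a =>
      simp only [Fin.snoc_castSucc, Fin.castSucc_lt_castSucc_iff] at hab ⊢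
      exact he hab

lemma Chier_in {j k : ℕ} (e : Fin k → Fin j) (he : StrictMono e) (A : Finset (Fin j))
    (hA : Finset.univ.image e = A) (a : Fin k) (V : Conf j) :
    Chier Bk (e a) (Fterm fam f (insert (Fin.last j) (A.map (Fin.last j).succAboveEmb))) V
      = Chier Bk a (fam (k+1)) (V ∘ e) * ∏ i ∈ Aᶜ, f (V i) := by
  rw [Chier_eq, Chier_eq, ← integral_mul_const]
  congr 1
  funext u
  set e' : Fin (k+1) → Fin (j+1) := Fin.snoc (fun a => (e a).castSucc) (Fin.last j) with he'
  have hs : StrictMono e' := snocE_strictMono e he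
  have himg : Finset.univ.image e' = insert (Fin.last j) (A.map (Fin.last j).succAboveEmb) := by
    ext x
    simp only [Finset.mem_image, Finset.mem_univ, true_and, Finset.mem_insert, Finset.mem_map]
    constructor
    · rintro ⟨b, rfl⟩
      induction b using Fin.lastCases with
      | last => left; simp [he']
      | cast b =>
        right
        exact ⟨e b, hA.subset (Finset.mem_image_of_mem _ (Finset.mem_univ _)), by simp [he']⟩
    · rintro (rfl | ⟨c, hc, rfl⟩)
      · exact ⟨Fin.last k, by simp [he']⟩
      · rw [← hA] at hc
        obtain ⟨b, -, rfl⟩ := Finset.mem_image.1 hc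
        exact ⟨b.castSucc, by simp [he']⟩
  have h1 : e' a.castSucc = (e a).castSucc := by simp [he']
  have h2 : e' (Fin.last k) = Fin.last j := by simp [he']
  rw [← h1]
  conv_lhs => enter [3]; rw [← h2]
  rw [KacT_Fterm fam f Bk e' hs _ himg]
  have h3 : (Fin.snoc V u : Conf (j+1)) ∘ e' = (Fin.snoc (V ∘ e) u : Conf (k+1)) := by
    funext b
    induction b using Fin.lastCases with
    | last => simp [he']
    | cast b => simp [he']
  rw [h3]
  congr 1
  rw [prod_compl, prod_compl, Fin.prod_univ_castSucc]
  simp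

lemma Fterm_castSucc {j : ℕ} (A : Finset (Fin j)) (W : Conf (j+1)) :
    Fterm fam f (A.map (Fin.last j).succAboveEmb) W
      = evalAt fam A (fun k => W k.castSucc) * (∏ i ∈ Aᶜ, f (W i.castSucc)) * f (W (Fin.last j)) := by
  unfold Fterm
  rw [evalAt_map fam _ (Fin.strictMono_succAbove _), prod_compl, prod_compl, Fin.prod_univ_castSucc]
  have h1 : W ∘ (Fin.last j).succAboveEmb = fun k => W k.castSucc := by
    funext k; simp
  rw [h1]
  simp
  ring

lemma Chier_out {j : ℕ} (A : Finset (Fin j)) (i : Fin j) (hi : i ∉ A) (V : Conf j) :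
    Chier Bk i (Fterm fam f (A.map (Fin.last j).succAboveEmb)) V
      = evalAt fam A V * ((∏ k ∈ Aᶜ.erase i, f (V k)) * Qcol Bk f (V i)) := by
  unfold Chier Qcol
  rw [← mul_assoc, ← integral_const_mul]
  congr 1
  funext u
  rw [← integral_const_mul]
  congr 1
  funext ω
  have hi' : i ∈ Aᶜ := Finset.mem_compl.2 hi
  rw [Fterm_castSucc, Fterm_castSucc, ← Finset.mul_prod_erase _ _ hi', ← Finset.mul_prod_erase _ _ hi']
  have e1 : ∀ (x y : V3) (k : Fin j), k ≠ i →
      (Function.update (Function.update (Fin.snoc V u : Conf (j+1)) i.castSucc x) (Fin.last j) y)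
        k.castSucc = V k := by
    intro x y k hk
    rw [Function.update_of_ne (Fin.castSucc_ne_last k), Function.update_of_ne
      (fun h => hk (Fin.castSucc_injective _ h))]
    simp
  have e2 : ∀ (x y : V3),
      (Function.update (Function.update (Fin.snoc V u : Conf (j+1)) i.castSucc x) (Fin.last j) y)
        i.castSucc = x := by
    intro x y
    rw [Function.update_of_ne (Fin.castSucc_ne_last i), Function.update_self]
  rw [evalAt_congr fam A (V := fun k => (Function.update (Function.update (Fin.snoc V u : Conf (j+1))
    i.castSucc _) (Fin.last j) _) k.castSucc) (W := V) fun k hk => e1 _ _ k fun h => hi (h ▸ hk)]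
  rw [Finset.prod_congr rfl (s₁ := Aᶜ.erase i)
    (f := fun k => f ((Function.update (Function.update (Fin.snoc V u : Conf (j+1))
    i.castSucc _) (Fin.last j) _) k.castSucc)) (g := fun k => f (V k))
    fun k hk => by rw [e1 _ _ k (Finset.ne_of_mem_erase hk)]]
  rw [e2, Function.update_self]
  simp only [Fin.snoc_castSucc, Fin.snoc_last]
  ring

lemma Chier_Fterm {j : ℕ} (A : Finset (Fin j)) (V : Conf j) :
    evalAt (fun k => ChierFull Bk (fam (k+1))) A V * ∏ i ∈ Aᶜ, f (V i)
      + evalAt fam A V * ∑ i ∈ Aᶜ, (∏ k ∈ Aᶜ.erase i, f (V k)) * Qcol Bk f (V i)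
      = ∑ i : Fin j, Chier Bk i (Fterm fam f (extA i A)) V := by
  set e := A.orderEmbOfFin rfl with he
  have himg : Finset.univ.image e = A := Finset.image_orderEmbOfFin_univ A rfl
  rw [← Finset.sum_add_sum_compl A]
  congr 1
  · conv_rhs => rw [← himg]
    rw [Finset.sum_image (fun x _ y _ h => e.injective h)]
    rw [evalAt_strictMono _ e e.strictMono A himg]
    unfold ChierFull
    rw [Finset.sum_mul]
    refine Finset.sum_congr rfl fun a _ => ?_
    have hm : e a ∈ A := himg.subset (Finset.mem_image_of_mem _ (Finset.mem_univ _))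
    rw [himg]
    simp only [extA, hm, if_true]
    exact (Chier_in fam f Bk e e.strictMono A himg a V).symm
  · rw [Finset.mul_sum]
    refine Finset.sum_congr rfl fun i hi => ?_
    have hm : i ∉ A := Finset.mem_compl.1 hi
    simp only [extA, hm, if_false]
    exact (Chier_out fam f Bk A i hm V).symm

/-- The time derivative of the correlation error. -/
def Dcorr (Bk : V3 → V3 → ℝ) (μ : ℝ) (fam : ∀ k : ℕ, Conf k → ℝ) (f : V3 → ℝ) (j : ℕ) :
    Conf j → ℝ := fun V =>
  ∑ A : Finset (Fin j), sg A * ((1 / μ) * (∑ i : Fin j, ∑ s : Fin j, if i < s then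
        (if i ∈ A ∧ s ∈ A then KacT Bk i s (Fterm fam f A) V else 0) else 0)
      + ∑ i : Fin j, Chier Bk i (Fterm fam f (extA i A)) V)

lemma corrErr_deriv (μ : ℝ) (fmu : ∀ j : ℕ, ℝ → Conf j → ℝ) (ft : ℝ → V3 → ℝ) (t : ℝ)
    (h0 : ∀ t V, fmu 0 t V = 1)
    (hd : ∀ j : ℕ, 1 ≤ j → ∀ V : Conf j, HasDerivAt (fun τ => fmu j τ V)
            ((1 / μ) * KacTn Bk (fmu j t) V + ChierFull Bk (fmu (j + 1) t) V) t)
    (hQ : ∀ v : V3, HasDerivAt (fun τ => ft τ v) (Qcol Bk (ft t) v) t) (j : ℕ) (V : Conf j) :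
    HasDerivAt (fun τ => corrErr (fun k => fmu k τ) (ft τ) j V)
      (Dcorr Bk μ (fun k => fmu k t) (ft t) j V) t := by
  have hd' : ∀ j : ℕ, ∀ V : Conf j, HasDerivAt (fun τ => fmu j τ V)
            ((1 / μ) * KacTn Bk (fmu j t) V + ChierFull Bk (fmu (j + 1) t) V) t := by
    intro j V
    rcases Nat.eq_zero_or_pos j with rfl | hj
    · simp only [h0]
      have : (1 / μ) * KacTn Bk (fmu 0 t) V + ChierFull Bk (fmu (0 + 1) t) V = 0 := by
        simp [KacTn, ChierFull]
      rw [this]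
      exact hasDerivAt_const _ _
    · exact hd j hj V
  simp only [corrErr_eq, Dcorr]
  refine HasDerivAt.fun_sum fun A _ => ?_
  refine HasDerivAt.const_mul _ ?_
  rw [← KacTn_Fterm (fun k => fmu k t) (ft t) Bk A V,
    ← Chier_Fterm (fun k => fmu k t) (ft t) Bk A V]
  have hE := hd' A.card (fun a => V ((A.orderIsoOfFin rfl a : Fin j)))
  have hP : HasDerivAt (fun τ => ∏ i ∈ Aᶜ, ft τ (V i))
      (∑ i ∈ Aᶜ, (∏ k ∈ Aᶜ.erase i, ft t (V k)) * Qcol Bk (ft t) (V i)) t := by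
    have := HasDerivAt.fun_finsetProd (u := Aᶜ) (f := fun i τ => ft τ (V i))
      (f' := fun i => Qcol Bk (ft t) (V i)) (x := t) (fun i _ => hQ (V i))
    simpa only [smul_eq_mul] using this
  refine (hE.mul hP).congr_deriv ?_
  simp only [evalAt]
  ring

lemma Dcorr_bound {Bsup : ℝ} (hB : IsKernel Bk Bsup) {μ : ℝ} (hμ : 0 < μ)
    (hfam : ∀ k, Integrable (fam k) ∧ L1n (fam k) = 1) (hf0 : ∀ v, 0 ≤ f v)
    (hfi : Integrable f) (hf1 : ∫ v, f v = 1) (j : ℕ) :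
    Integrable (Dcorr Bk μ fam f j) ∧ L1n (Dcorr Bk μ fam f j) ≤
      (1 / μ) * ((j : ℝ)^2 * (betaE Bsup * (L1n (corrErr fam f j) + 2 * L1n (corrErr fam f (j-1))
        + L1n (corrErr fam f (j-2)))))
      + j * (betaE Bsup * (L1n (corrErr fam f (j+1)) + 2 * L1n (corrErr fam f j))) := by
  have hFi : ∀ {n : ℕ} (A : Finset (Fin n)), Integrable (Fterm fam f A) := fun A =>
    (Fterm_good hfam hf0 hfi hf1 A).1
  have hL : ∀ n, 0 ≤ L1n (corrErr fam f n) := fun n => integral_nonneg fun V => abs_nonneg _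
  have hβ := betaE_nonneg Bsup
  let PK : Fin j → Fin j → Conf j → ℝ := fun i s V =>
    if i < s then KacT Bk i s (Psum fam f (Finset.univ.filter fun A => i ∈ A ∧ s ∈ A)) V else 0
  let PC : Fin j → Conf j → ℝ := fun i =>
    Chier Bk i (fun V => ∑ A : Finset (Fin j), sg A * Fterm fam f (extA i A) V)
  have hPI := fun S : Finset (Finset (Fin j)) => Psum_integrable hfam hf0 hfi hf1 S
  have hCI : ∀ i : Fin j, Integrable (fun V => ∑ A : Finset (Fin j),
      sg A * Fterm fam f (extA i A) V) := fun i =>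
    integrable_finsetSum _ fun A _ => (hFi _).const_mul _
  have hPKi : ∀ i s, Integrable (PK i s) := by
    intro i s
    by_cases h : i < s
    · simp only [PK, h, if_true]
      exact KacT_integrable hB h.ne (hPI _)
    · simp only [PK, h, if_false]
      exact integrable_zero _ _ _
  have hPCi : ∀ i, Integrable (PC i) := fun i => Chier_integrable hB (hCI i)
  have hPKn : ∀ i s, L1n (PK i s) ≤ betaE Bsup * (L1n (corrErr fam f j)
      + 2 * L1n (corrErr fam f (j-1)) + L1n (corrErr fam f (j-2))) := by
    intro i s
    by_cases h : i < s
    · simp only [PK, h, if_true]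
      refine (KacT_L1 hB h.ne (hPI _)).trans (mul_le_mul_of_nonneg_left ?_ hβ)
      obtain ⟨m, rfl⟩ : ∃ m, j = m + 2 := ⟨j - 2, by have := i.2; have := s.2; have : (i:ℕ) < s := h; omega⟩
      exact Psum_both hfam hf0 hfi hf1 i s h.ne
    · simp only [PK, h, if_false]
      have : L1n (fun _ : Conf j => (0:ℝ)) = 0 := by simp [L1n]
      rw [this]
      have := hL j; have := hL (j-1); have := hL (j-2)
      positivity
  have hPCn : ∀ i, L1n (PC i) ≤ betaE Bsup * (L1n (corrErr fam f (j+1))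
      + 2 * L1n (corrErr fam f j)) := fun i =>
    (Chier_L1 hB (hCI i)).trans (mul_le_mul_of_nonneg_left (Pext hfam hf0 hfi hf1 i) hβ)
  have hKae : ∀ᵐ V : Conf j, ∀ i s : Fin j, i < s →
      KacT Bk i s (Psum fam f (Finset.univ.filter fun A => i ∈ A ∧ s ∈ A)) V
        = ∑ A with (i ∈ A ∧ s ∈ A), sg A * KacT Bk i s (Fterm fam f A) V := by
    rw [ae_all_iff]; intro i
    rw [ae_all_iff]; intro s
    by_cases h : i < s
    · filter_upwards [KacT_sum (Finset.univ.filter fun A => i ∈ A ∧ s ∈ A) sg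
        (fun A => Fterm fam f A) hB h.ne (fun A _ => hFi A)] with V hV _ using hV
    · exact Filter.Eventually.of_forall fun V h' => absurd h' h
  have hCae : ∀ᵐ V : Conf j, ∀ i : Fin j,
      PC i V = ∑ A : Finset (Fin j), sg A * Chier Bk i (Fterm fam f (extA i A)) V := by
    rw [ae_all_iff]; intro i
    exact Chier_sum Finset.univ sg (fun A => Fterm fam f (extA i A)) hB (fun A _ => hFi _)
  let R : Conf j → ℝ := fun V => (1 / μ) * (∑ i, ∑ s, PK i s V) + ∑ i, PC i V
  have hDR : Dcorr Bk μ fam f j =ᵐ[volume] R := by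
    filter_upwards [hKae, hCae] with V hK hC
    simp only [Dcorr, R, PK, mul_add, Finset.sum_add_distrib]
    congr 1
    · have : ∀ i s : Fin j, (if i < s then KacT Bk i s
          (Psum fam f (Finset.univ.filter fun A => i ∈ A ∧ s ∈ A)) V else 0)
          = ∑ A : Finset (Fin j), sg A * (if i < s then
        (if i ∈ A ∧ s ∈ A then KacT Bk i s (Fterm fam f A) V else 0) else 0) := by
        intro i s
        by_cases h : i < s
        · simp only [h, if_true]
          rw [hK i s h, Finset.sum_filter]
          exact Finset.sum_congr rfl fun A _ => by split_ifs <;> simp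
        · simp [h]
      simp only [this]
      have h2 : ∀ i : Fin j, ∑ s : Fin j, ∑ A : Finset (Fin j), sg A * (if i < s then
        (if i ∈ A ∧ s ∈ A then KacT Bk i s (Fterm fam f A) V else 0) else 0)
         = ∑ A : Finset (Fin j), sg A * ∑ s : Fin j, (if i < s then
        (if i ∈ A ∧ s ∈ A then KacT Bk i s (Fterm fam f A) V else 0) else 0) := by
        intro i
        rw [Finset.sum_comm]
        simp only [Finset.mul_sum]
      simp only [h2]
      rw [Finset.sum_comm, Finset.mul_sum]
      refine Finset.sum_congr rfl fun A _ => ?_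
      rw [← Finset.mul_sum]
      ring
    · simp only [hC]
      rw [Finset.sum_comm]
      exact Finset.sum_congr rfl fun A _ => by rw [Finset.mul_sum]
  have hKsum : ∀ i, Integrable (fun V => ∑ s, PK i s V) := fun i =>
    integrable_finsetSum _ fun s _ => hPKi i s
  have hKsum2 : Integrable (fun V => ∑ i, ∑ s, PK i s V) :=
    integrable_finsetSum _ fun i _ => hKsum i
  have hCsum : Integrable (fun V => ∑ i, PC i V) :=
    integrable_finsetSum _ fun i _ => hPCi i
  have hRi : Integrable R := (hKsum2.const_mul _).add hCsum
  refine ⟨hRi.congr hDR.symm, ?_⟩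
  have hLe : L1n (Dcorr Bk μ fam f j) = L1n R := by
    unfold L1n
    refine integral_congr_ae ?_
    filter_upwards [hDR] with V hV
    rw [hV]
  rw [hLe]
  refine (sum_L1_le (hKsum2.const_mul _) hCsum).trans ?_
  rw [smul_L1, abs_of_pos (by positivity : 0 < 1 / μ)]
  refine add_le_add (mul_le_mul_of_nonneg_left ?_ (by positivity)) ?_
  · refine (finsum_L1_le _ _ fun i _ => hKsum i).trans ?_
    refine (Finset.sum_le_sum fun i _ => (finsum_L1_le _ _ fun s _ => hPKi i s).trans
      (Finset.sum_le_sum fun s _ => hPKn i s)).trans ?_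
    simp only [Finset.sum_const, Finset.card_univ, Fintype.card_fin, nsmul_eq_mul]
    rw [← mul_assoc, pow_two]
  · refine (finsum_L1_le _ _ fun i _ => hPCi i).trans ?_
    refine (Finset.sum_le_sum fun i _ => hPCn i).trans ?_
    simp only [Finset.sum_const, Finset.card_univ, Fintype.card_fin, nsmul_eq_mul]
    exact le_rfl

end Deriv

section ODE

/-- The weights `(j ε)^j`. -/
def wt (ε : ℝ) (j : ℕ) : ℝ := ((j : ℝ) * ε) ^ j

lemma wt_pred1 {ε : ℝ} (hε : 0 < ε) {j : ℕ} (hj : 1 ≤ j) (h : (j:ℝ) * ε < 1) :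
    ((j:ℝ) * ε)^2 * wt ε (j-1) ≤ wt ε j := by
  obtain ⟨k, rfl⟩ : ∃ k, j = k + 1 := ⟨j - 1, by omega⟩
  have hq : 0 ≤ ((k+1 : ℕ):ℝ) * ε := by positivity
  have h1 : wt ε k ≤ (((k+1 : ℕ):ℝ) * ε)^k := by
    unfold wt
    refine pow_le_pow_left₀ (by positivity) ?_ _
    push_cast; nlinarith
  calc (((k+1 : ℕ):ℝ) * ε)^2 * wt ε (k+1-1)
      ≤ (((k+1 : ℕ):ℝ) * ε)^2 * (((k+1 : ℕ):ℝ) * ε)^k := by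
        gcongr
        exact h1
    _ = (((k+1 : ℕ):ℝ) * ε)^(k+2) := by ring
    _ ≤ (((k+1 : ℕ):ℝ) * ε)^(k+1) := pow_le_pow_of_le_one hq h.le (by omega)

lemma wt_pred2 {ε : ℝ} (hε : 0 < ε) {j : ℕ} (hj : 1 ≤ j) (h : (j:ℝ) * ε < 1) :
    ((j:ℝ) * ε)^2 * wt ε (j-2) ≤ wt ε j := by
  rcases Nat.lt_or_ge j 2 with h2 | h2
  · obtain rfl : j = 1 := by omega
    simp only [wt, Nat.cast_one, one_mul] at h ⊢
    norm_num
    nlinarith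
  obtain ⟨k, rfl⟩ : ∃ k, j = k + 2 := ⟨j - 2, by omega⟩
  have h1 : wt ε k ≤ (((k+2 : ℕ):ℝ) * ε)^k := by
    unfold wt
    refine pow_le_pow_left₀ (by positivity) ?_ _
    push_cast; nlinarith
  calc (((k+2 : ℕ):ℝ) * ε)^2 * wt ε (k+2-2)
      ≤ (((k+2 : ℕ):ℝ) * ε)^2 * (((k+2 : ℕ):ℝ) * ε)^k := by
        gcongr
        exact h1
    _ = (((k+2 : ℕ):ℝ) * ε)^(k+2) := by ring

lemma wt_succ {ε : ℝ} (hε : 0 < ε) {j : ℕ} (hj : 1 ≤ j) (h : (j:ℝ) * ε < 1) :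
    wt ε (j+1) ≤ 6 * wt ε j := by
  have hj' : (1:ℝ) ≤ j := by exact_mod_cast hj
  have h1 : ((j+1 : ℕ) : ℝ) * ε ≤ 2 := by push_cast; nlinarith
  have h2 : (1 + 1 / (j:ℝ))^j ≤ 3 := by
    have e1 : (1 + 1 / (j:ℝ)) ≤ Real.exp (1 / (j:ℝ)) := by
      linarith [Real.add_one_le_exp (1 / (j:ℝ))]
    calc (1 + 1 / (j:ℝ))^j ≤ (Real.exp (1 / (j:ℝ)))^j := pow_le_pow_left₀ (by positivity) e1 _
      _ = Real.exp 1 := by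
        rw [← Real.exp_nat_mul]
        congr 1
        field_simp
      _ ≤ 3 := by linarith [Real.exp_one_lt_d9]
  have h3 : ((j+1 : ℕ) : ℝ) * ε = (1 + 1 / (j:ℝ)) * (j * ε) := by
    push_cast; field_simp
  have h0 : 0 ≤ wt ε j := by unfold wt; positivity
  calc wt ε (j+1) = (((j+1 : ℕ) : ℝ) * ε) * (((j+1 : ℕ) : ℝ) * ε)^j := by
        unfold wt; rw [pow_succ]; ring
    _ = (((j+1 : ℕ) : ℝ) * ε) * ((1 + 1 / (j:ℝ))^j * wt ε j) := by
        conv_lhs => enter [2]; rw [h3, mul_pow]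
        rfl
    _ ≤ 2 * (3 * wt ε j) := by
        gcongr
    _ = 6 * wt ε j := by ring

lemma rate_alg {β C₀ ε : ℝ} (hβ : 0 ≤ β) (hC₀ : 1 ≤ C₀) (hε : 0 < ε) {j N : ℕ} (hj : 1 ≤ j)
    (hj1 : (j:ℝ) * ε < 1) (hjNr : (j:ℝ) ≤ N) {m d E0 E1 E2 E3 : ℝ} (hM1 : 1 ≤ m) (hδr : 0 ≤ d)
    (i0 : E0 ≤ wt ε j * m^j + d) (i1 : E1 ≤ wt ε (j-1) * m^(j-1) + d)
    (i2 : E2 ≤ wt ε (j-2) * m^(j-2) + d) (i3 : E3 ≤ wt ε (j+1) * m^(j+1) + d) :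
    ((j:ℝ) * ε)^2 * (β * (E0 + 2 * E1 + E2)) + j * (β * (E3 + 2 * E0)) ≤
      wt ε j * (j * m^(j-1) * (24 * (β + 1) * C₀ * m^2 / (2 * C₀)))
        + β * (4 + 3 * N) * d := by
  have hjr : (1:ℝ) ≤ j := by exact_mod_cast hj
  have hq0 : 0 ≤ (j:ℝ) * ε := by positivity
  have hx1 : ((j:ℝ) * ε)^2 ≤ 1 := pow_le_one₀ hq0 hj1.le
  have hx0 : 0 ≤ ((j:ℝ) * ε)^2 := by positivity
  have w0 : 0 ≤ wt ε j := by unfold wt; positivity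
  -- powers
  have p0 : m^j ≤ m^(j+1) := pow_le_pow_right₀ hM1 (by omega)
  have p1 : m^(j-1) ≤ m^(j+1) := pow_le_pow_right₀ hM1 (by omega)
  have p2 : m^(j-2) ≤ m^(j+1) := pow_le_pow_right₀ hM1 (by omega)
  have hP : 0 ≤ m^(j+1) := by positivity
  obtain ⟨P, hPdef⟩ : ∃ P, P = m^(j+1) := ⟨_, rfl⟩
  rw [← hPdef] at p0 p1 p2 hP i3
  have q1 := wt_pred1 hε hj hj1
  have q2 := wt_pred2 hε hj hj1
  have q3 := wt_succ hε hj hj1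
  obtain ⟨x, hx⟩ : ∃ x, x = ((j:ℝ) * ε)^2 := ⟨_, rfl⟩
  rw [← hx] at hx0 hx1 q1 q2 ⊢
  have a0 : x * (wt ε j * m^j) ≤ wt ε j * P :=
    calc x * (wt ε j * m^j) ≤ 1 * (wt ε j * P) := by gcongr
      _ = _ := one_mul _
  have a1 : x * (wt ε (j-1) * m^(j-1)) ≤ wt ε j * P :=
    calc x * (wt ε (j-1) * m^(j-1)) = (x * wt ε (j-1)) * m^(j-1) := by ring
      _ ≤ wt ε j * P := by
        gcongr
  have a2 : x * (wt ε (j-2) * m^(j-2)) ≤ wt ε j * P :=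
    calc x * (wt ε (j-2) * m^(j-2)) = (x * wt ε (j-2)) * m^(j-2) := by ring
      _ ≤ wt ε j * P := by
        gcongr
  have a3 : wt ε (j+1) * P ≤ 6 * (wt ε j * P) :=
    calc wt ε (j+1) * P ≤ (6 * wt ε j) * P := by
            gcongr
      _ = _ := by ring
  have a4 : wt ε j * m^j ≤ wt ε j * P := by gcongr
  have hWP : 0 ≤ wt ε j * P := by positivity
  have b1 : x * (E0 + 2 * E1 + E2) ≤ 4 * (wt ε j * P) + 4 * d := by
    have : x * (E0 + 2 * E1 + E2) ≤
        x * ((wt ε j * m^j + d) + 2 * (wt ε (j-1) * m^(j-1) + d)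
          + (wt ε (j-2) * m^(j-2) + d)) := by gcongr
    have hxd : x * d ≤ 1 * d := by gcongr
    linarith
  have b2 : j * (E3 + 2 * E0) ≤ j * (8 * (wt ε j * P) + 3 * d) := by
    refine mul_le_mul_of_nonneg_left ?_ (by positivity)
    linarith
  have b3 : (j:ℝ) * (3 * d) ≤ N * (3 * d) := by gcongr
  have b4 : 4 * (wt ε j * P) ≤ j * (4 * (wt ε j * P)) := by
    nlinarith
  have hgoal : wt ε j * (j * m^(j-1) * (24 * (β + 1) * C₀ * m^2 / (2 * C₀)))
      = (β + 1) * (j * (12 * (wt ε j * P))) := by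
    have : P = m^(j-1) * m^2 := by rw [hPdef, ← pow_add]; congr 1; omega
    rw [this]; field_simp; ring
  rw [hgoal]
  calc x * (β * (E0 + 2 * E1 + E2)) + j * (β * (E3 + 2 * E0))
      = β * (x * (E0 + 2 * E1 + E2) + j * (E3 + 2 * E0)) := by ring
    _ ≤ β * (j * (12 * (wt ε j * P)) + (4 + 3 * N) * d) := by
        refine mul_le_mul_of_nonneg_left ?_ hβ
        linarith
    _ = β * (j * (12 * (wt ε j * P))) + β * (4 + 3 * N) * d := by ring
    _ ≤ (β + 1) * (j * (12 * (wt ε j * P))) + β * (4 + 3 * N) * d := by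
        have : 0 ≤ (j:ℝ) * (12 * (wt ε j * P)) := by positivity
        linarith

lemma ode_core {β C₀ ε : ℝ} (hβ : 0 ≤ β) (hC₀ : 1 ≤ C₀) (hε : 0 < ε) (e : ℕ → ℝ → ℝ)
    (he2 : ∀ j t, 0 ≤ t → e j t ≤ 2 ^ j)
    (hinit : ∀ j : ℕ, 1 ≤ j → e j 0 ≤ wt ε j * C₀ ^ j)
    (hint : ∀ j : ℕ, 1 ≤ j → ∀ T, 0 ≤ T → ∀ G g : ℝ → ℝ,
      (∀ t, 0 ≤ t → t ≤ T → HasDerivAt G (g t) t) → ContinuousOn g (Set.Icc 0 T) →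
      (∀ t, 0 ≤ t → t ≤ T →
        ((j:ℝ) * ε)^2 * (β * (e j t + 2 * e (j-1) t + e (j-2) t))
          + j * (β * (e (j+1) t + 2 * e j t)) ≤ g t) →
      e j T ≤ e j 0 + (G T - G 0))
    (t : ℝ) (ht0 : 0 ≤ t) (ht : t ≤ 1 / (48 * (β + 1) * C₀)) (j : ℕ) :
    e j t ≤ wt ε j * (4 * C₀) ^ j := by
  set C : ℝ := 24 * (β + 1) * C₀ with hC
  have hCpos : 0 < C := by positivity
  set t₀ : ℝ := 1 / (48 * (β + 1) * C₀) with ht₀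
  have hCt : C * t₀ = 1 / 2 := by
    rw [hC, ht₀]; field_simp; norm_num
  let M : ℝ → ℝ := fun s => 2 * C₀ * (1 - C * s)⁻¹
  have hden : ∀ s, s ≤ t₀ → 1 / 2 ≤ 1 - C * s := by
    intro s hs
    nlinarith
  have hM2 : ∀ s, 0 ≤ s → s ≤ t₀ → 2 * C₀ ≤ M s := by
    intro s h0 hs
    have h1 := hden s hs
    have : 1 ≤ (1 - C * s)⁻¹ := (one_le_inv₀ (by linarith)).2 (by nlinarith)
    simp only [M]
    nlinarith
  have hM4 : ∀ s, s ≤ t₀ → M s ≤ 4 * C₀ := by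
    intro s hs
    have h1 := hden s hs
    have : (1 - C * s)⁻¹ ≤ 2 := by
      rw [inv_le_comm₀ (by linarith) (by norm_num)]; linarith
    simp only [M]
    nlinarith
  have hMd : ∀ s, s ≤ t₀ → HasDerivAt M (C * (M s)^2 / (2 * C₀)) s := by
    intro s hs
    have h1 := hden s hs
    have hne : 1 - C * s ≠ 0 := by linarith
    have hl : HasDerivAt (fun s => 1 - C * s) (-C) s := by
      simpa using ((hasDerivAt_id s).const_mul C).const_sub 1
    have := (hl.inv hne).const_mul (2 * C₀)
    refine this.congr_deriv ?_
    simp only [M]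
    field_simp
  have hMc : ContinuousOn M (Set.Icc 0 t₀) := fun s hs =>
    (hMd s hs.2).continuousAt.continuousWithinAt
  have hw : ∀ j, 0 ≤ wt ε j := fun j => by unfold wt; positivity
  have hy : ∀ j s, 0 ≤ s → s ≤ t₀ → 0 ≤ wt ε j * (M s)^j := by
    intro j s h0 hs
    have h1 : 0 ≤ M s := by linarith [hM2 s h0 hs]
    exact mul_nonneg (hw j) (pow_nonneg h1 _)
  obtain ⟨N, hN⟩ := exists_nat_ge (1 / ε)
  have hjN : ∀ j : ℕ, (j:ℝ) * ε < 1 → j ≤ N := by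
    intro j hj
    have : (j:ℝ) < 1 / ε := by rwa [lt_div_iff₀ hε]
    exact_mod_cast (this.le.trans hN)
  -- trivial region
  have htriv : ∀ j : ℕ, (j = 0 ∨ 1 ≤ (j:ℝ) * ε) → ∀ s, 0 ≤ s → s ≤ t₀ →
      e j s ≤ wt ε j * (M s)^j := by
    intro j hj s h0 hs
    refine (he2 j s h0).trans ?_
    rcases hj with rfl | hj
    · simp [wt]
    · have h1 : 1 ≤ wt ε j := one_le_pow₀ hj
      have h2 : (2:ℝ)^j ≤ (M s)^j := pow_le_pow_left₀ (by norm_num)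
        (by linarith [hM2 s h0 hs]) _
      calc (2:ℝ)^j ≤ (M s)^j := h2
        _ = 1 * (M s)^j := (one_mul _).symm
        _ ≤ wt ε j * (M s)^j := by
          have h3 : 0 ≤ M s := by linarith [hM2 s h0 hs]
          exact mul_le_mul_of_nonneg_right h1 (pow_nonneg h3 _)
  set K : ℝ := β * (4 + 3 * N) with hK
  have hK0 : 0 ≤ K := by positivity
  let δ : ℕ → ℝ → ℝ := fun n s => 2^N * ((K * s)^n / (n.factorial : ℝ))
  have hδ0 : ∀ n s, 0 ≤ s → 0 ≤ δ n s := by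
    intro n s hs
    simp only [δ]; positivity
  have hδd : ∀ n s, HasDerivAt (δ (n+1)) (K * δ n s) s := by
    intro n s
    have h1 : HasDerivAt (fun s => K * s) K s := by
      simpa using (hasDerivAt_id s).const_mul K
    have := ((h1.pow (n+1)).div_const ((n+1).factorial : ℝ)).const_mul (2^N : ℝ)
    refine this.congr_deriv ?_
    simp only [δ, Nat.factorial_succ, Nat.add_sub_cancel]
    have : (n.factorial : ℝ) ≠ 0 := by positivity
    push_cast
    field_simp
  have hδc : ∀ n, Continuous (δ n) := by
    intro n; simp only [δ]; fun_prop
  have main : ∀ n : ℕ, ∀ j : ℕ, ∀ s, 0 ≤ s → s ≤ t₀ →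
      e j s ≤ wt ε j * (M s)^j + δ n s := by
    intro n
    induction n with
    | zero =>
      intro j s h0 hs
      by_cases hj : (j:ℝ) * ε < 1
      · have h1 : (2:ℝ)^j ≤ 2^N := pow_le_pow_right₀ (by norm_num) (hjN j hj)
        have := he2 j s h0
        have := hy j s h0 hs
        simp only [δ, pow_zero, Nat.factorial_zero, Nat.cast_one, div_one, mul_one]
        linarith
      · have := htriv j (Or.inr (not_lt.1 hj)) s h0 hs
        have := hδ0 0 s h0
        linarith
    | succ n ih =>
      intro j s h0 hs
      by_cases hj : (j = 0 ∨ 1 ≤ (j:ℝ) * ε)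
      · have := htriv j hj s h0 hs
        have := hδ0 (n+1) s h0
        linarith
      push Not at hj
      obtain ⟨hj0, hj1⟩ := hj
      have hj : 1 ≤ j := Nat.one_le_iff_ne_zero.2 hj0
      have hjr : (1:ℝ) ≤ j := by exact_mod_cast hj
      have hjNr : (j:ℝ) ≤ N := by exact_mod_cast hjN j hj1
      have hq0 : 0 ≤ (j:ℝ) * ε := by positivity
      have hx1 : ((j:ℝ) * ε)^2 ≤ 1 := pow_le_one₀ hq0 hj1.le
      have hx0 : 0 ≤ ((j:ℝ) * ε)^2 := by positivity
      have hres := hint j hj s h0 (fun r => wt ε j * (M r)^j + δ (n+1) r)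
        (fun r => wt ε j * (j * (M r)^(j-1) * (C * (M r)^2 / (2 * C₀))) + K * δ n r) ?_ ?_ ?_
      · have hi := hinit j hj
        have hM0 : M 0 = 2 * C₀ := by simp [M]
        have hd0 : δ (n+1) 0 = 0 := by simp [δ]
        simp only [hM0, hd0] at hres
        have h3 : wt ε j * C₀^j ≤ wt ε j * (2 * C₀)^j := by
          have := hw j
          gcongr
          linarith
        linarith
      · intro r hr0 hrs
        exact (((hMd r (hrs.trans hs)).pow j).const_mul _).add (hδd n r)
      · have hMc' : ContinuousOn M (Set.Icc 0 s) := hMc.mono (Set.Icc_subset_Icc_right hs)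
        have := hδc n
        refine ContinuousOn.add ?_ (this.continuousOn.const_mul K |> fun h => h)
        exact ContinuousOn.mul continuousOn_const
          (ContinuousOn.mul (ContinuousOn.mul continuousOn_const (hMc'.pow _))
            (ContinuousOn.div_const (ContinuousOn.mul continuousOn_const (hMc'.pow _)) _))
      · intro r hr0 hrs
        have hrt := hrs.trans hs
        have i0 := ih j r hr0 hrt
        have i1 := ih (j-1) r hr0 hrt
        have i2 := ih (j-2) r hr0 hrt
        have i3 := ih (j+1) r hr0 hrt
        have hδr := hδ0 n r hr0
        have hMr := hM2 r hr0 hrt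
        exact rate_alg hβ hC₀ hε hj hj1 hjNr (by linarith) hδr i0 i1 i2 i3
  have hlim : Filter.Tendsto (fun n => wt ε j * (M t)^j + δ n t) Filter.atTop
      (nhds (wt ε j * (M t)^j + 2^N * 0)) := by
    refine tendsto_const_nhds.add (Filter.Tendsto.const_mul _ ?_)
    exact FloorSemiring.tendsto_pow_div_factorial_atTop (K * t)
  have hle := ge_of_tendsto' hlim (fun n => main n j t ht0 ht)
  rw [mul_zero, add_zero] at hle
  refine hle.trans ?_
  have h1 := hM2 t ht0 ht
  have h2 := hM4 t ht
  exact mul_le_mul_of_nonneg_left (pow_le_pow_left₀ (by linarith) h2 _) (hw j)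

end ODE

lemma wt_eq {μ : ℝ} (hμ : 0 < μ) (j : ℕ) :
    ((j : ℝ) ^ 2 / μ) ^ ((j : ℝ) / 2) = wt (√μ)⁻¹ j := by
  have h1 : (j : ℝ) ^ 2 / μ = ((j:ℝ) * (√μ)⁻¹)^2 := by
    rw [mul_pow, inv_pow, Real.sq_sqrt hμ.le]; rfl
  have h0 : 0 ≤ (j:ℝ) * (√μ)⁻¹ := by positivity
  unfold wt
  rw [h1, ← Real.rpow_natCast _ 2, ← Real.rpow_mul h0, ← Real.rpow_natCast _ j]
  congr 1
  push_cast
  ring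

lemma fam_zero {g : Conf 0 → ℝ} (h : ∀ V, g V = 1) : Integrable g ∧ L1n g = 1 := by
  have hg : g = fun _ => 1 := funext h
  have hv : (volume : Measure (Conf 0)) = Measure.dirac default := by
    rw [volume_pi, Measure.pi_of_empty _ default]
  constructor
  · rw [hg, hv]; exact integrable_const _
  · rw [hg]; unfold L1n; rw [hv]; simp

/-- **Short-time propagation of bounds on correlation errors (Proposition 4.1).**
If `‖E_j(0)‖₁ ≤ (j²/μ)^{j/2} C₀^j` for all `j ≥ 1`, then there are `t₀ > 0` and `A > 0`
(depending only on `‖B‖_∞` and `C₀`) such that `‖E_j(t)‖₁ ≤ (j²/μ)^{j/2} (A C₀)^j`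
for all `0 ≤ t ≤ t₀` and all `j ≥ 1`. -/
theorem correlation_error_short_time_bound (Bsup C₀ : ℝ) (hC₀ : 1 ≤ C₀) :
    ∃ t₀ > (0 : ℝ), ∃ A > (0 : ℝ),
      ∀ (Bk : V3 → V3 → ℝ), IsKernel Bk Bsup →
      ∀ (μ : ℝ), 0 < μ →
      ∀ (fmu : ∀ j : ℕ, ℝ → Conf j → ℝ) (f : ℝ → V3 → ℝ),
        -- convention `f^μ_0 = 1`
        (∀ t V, fmu 0 t V = 1) →
        -- each `f^μ_j(t)` is a nonnegative symmetric probability density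
        (∀ (j : ℕ), 1 ≤ j → ∀ (t : ℝ), 0 ≤ t →
          IsSymm' (fmu j t) ∧ (∀ V, 0 ≤ fmu j t V) ∧ Integrable (fmu j t) ∧
            L1n (fmu j t) = 1) →
        -- grand-canonical BBGKY hierarchy
        (∀ (j : ℕ), 1 ≤ j → ∀ (t : ℝ), 0 ≤ t → ∀ V : Conf j,
          HasDerivAt (fun τ => fmu j τ V)
            ((1 / μ) * KacTn Bk (fmu j t) V + ChierFull Bk (fmu (j + 1) t) V) t) →
        -- `f` is a probability-density solution of the homogeneous Boltzmann equation
        SolvesBoltzmann Bk f →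
        -- initial bound on correlation errors
        (∀ j : ℕ, 1 ≤ j →
          L1n (corrErr (fun k => fmu k 0) (f 0) j) ≤
            ((j : ℝ) ^ 2 / μ) ^ ((j : ℝ) / 2) * C₀ ^ j) →
        -- conclusion
        ∀ (t : ℝ), 0 ≤ t → t ≤ t₀ → ∀ j : ℕ, 1 ≤ j →
          L1n (corrErr (fun k => fmu k t) (f t) j) ≤
            ((j : ℝ) ^ 2 / μ) ^ ((j : ℝ) / 2) * (A * C₀) ^ j := by
  have hβ := betaE_nonneg Bsup
  refine ⟨1 / (48 * (betaE Bsup + 1) * C₀), by positivity, 4, by norm_num, ?_⟩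
  intro Bk hB μ hμ fmu f h0 hdens hbb hboltz hinit t ht0 ht j hj
  have hε : 0 < (√μ)⁻¹ := by positivity
  have hfam : ∀ t, 0 ≤ t → ∀ k, Integrable (fmu k t) ∧ L1n (fmu k t) = 1 := by
    intro t ht k
    rcases Nat.eq_zero_or_pos k with rfl | hk
    · exact fam_zero (h0 t)
    · exact (hdens k hk t ht).2.2
  rw [wt_eq hμ]
  refine ode_core hβ hC₀ hε (fun j t => L1n (corrErr (fun k => fmu k t) (f t) j)) ?_ ?_ ?_
    t ht0 ht j
  · intro j t ht
    obtain ⟨a, b, c⟩ := hboltz.1 t ht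
    exact corrErr_le (hfam t ht) a b c j
  · intro j hj
    rw [← wt_eq hμ]
    exact hinit j hj
  · intro j hj T hT G g hG hgc hrate
    refine time_bound (fun t => corrErr (fun k => fmu k t) (f t) j)
      (fun t => Dcorr Bk μ (fun k => fmu k t) (f t) j) ?_ ?_ T hT G g hG hgc ?_
    · intro t ht V
      exact corrErr_deriv Bk μ fmu f t h0 (fun j hj V => hbb j hj t ht V) (hboltz.2 t ht) j V
    · intro t ht
      obtain ⟨a, b, c⟩ := hboltz.1 t ht
      exact corrErr_integrable (hfam t ht) a b c j
    · intro t ht htT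
      obtain ⟨a, b, c⟩ := hboltz.1 t ht
      obtain ⟨d1, d2⟩ := Dcorr_bound (fun k => fmu k t) (f t) Bk hB hμ (hfam t ht) a b c j
      refine ⟨d1, d2.trans (le_trans (le_of_eq ?_) (hrate t ht htT))⟩
      have : ((j:ℝ) * (√μ)⁻¹)^2 = (1 / μ) * (j:ℝ)^2 := by
        rw [mul_pow, inv_pow, Real.sq_sqrt hμ.le]; ring
      rw [this]
      ring

end
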